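/- Let (X, d) be a compact metric space and T : X → X a continuous map with positive topological entropy h_top(T) > 0. Then there exists an uncountable set E ⊆ X such that every pair of distinct points x, y ∈ E is DC2-scrambled for T. -/

import Mathlib

open Filter

/-- The upper density with which the orbits of `x` and `y` under `T` are `t`-close up to time
`n`: the fraction of times `i ∈ [0, n-1]` with `dist (T^[i] x) (T^[i] y) < t`. -/
noncomputable def closeTimesFraction {X : Type*} [MetricSpace X] (T : X → X)
    (x y : X) (t : ℝ) (n : ℕ) : ℝ :=
  (((Finset.range n).filter (fun i => dist (T^[i] x) (T^[i] y) < t)).card : ℝ) / n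

/-- A pair `(x, y)` is DC2-scrambled for `T` if for every `t > 0` the upper density of times at
which the orbits are `t`-close is `1`, while for some `t₀ > 0` the lower density of times at
which the orbits are `t₀`-close is less than `1`. -/
noncomputable def IsDC2Pair {X : Type*} [MetricSpace X] (T : X → X) (x y : X) : Prop :=
  (∀ t : ℝ, 0 < t →
      Filter.limsup (fun n : ℕ => closeTimesFraction T x y t n) Filter.atTop = 1) ∧
  (∃ t₀ : ℝ, 0 < t₀ ∧
      Filter.liminf (fun n : ℕ => closeTimesFraction T x y t₀ n) Filter.atTop < 1)

namespace DC2

/-! ### Shannon entropy of finite families of variables on a finite uniform space -/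

/-- Two sample points agree on all variables in `F`. -/
def Agree {ι J : Type*} (V : J → ι → ℕ) (F : Finset J) (s s' : ι) : Prop :=
  ∀ j ∈ F, V j s' = V j s

open Classical in
/-- The joint value of the variables in `F`. -/
noncomputable def nm {ι J : Type*} (V : J → ι → ℕ) (F : Finset J) (s : ι) : J → ℕ :=
  fun j => if j ∈ F then V j s else 0

lemma nm_eq_iff {ι J : Type*} (V : J → ι → ℕ) (F : Finset J) (s s' : ι) :
    nm V F s' = nm V F s ↔ Agree V F s s' := by
  constructor
  · intro h j hj
    have := congrFun h j
    simpa [nm, hj] using this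
  · intro h
    funext j
    by_cases hj : j ∈ F
    · simp [nm, hj, h j hj]
    · simp [nm, hj]

lemma Agree.symm {ι J : Type*} {V : J → ι → ℕ} {F : Finset J} {s s' : ι}
    (h : Agree V F s s') : Agree V F s' s := fun j hj => (h j hj).symm

lemma Agree.trans {ι J : Type*} {V : J → ι → ℕ} {F : Finset J} {s s' s'' : ι}
    (h : Agree V F s s') (h' : Agree V F s' s'') : Agree V F s s'' :=
  fun j hj => (h' j hj).trans (h j hj)

lemma Agree.mono {ι J : Type*} {V : J → ι → ℕ} {F G : Finset J} {s s' : ι}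
    (h : Agree V G s s') (hFG : F ⊆ G) : Agree V F s s' :=
  fun j hj => h j (hFG hj)

lemma Agree.refl {ι J : Type*} (V : J → ι → ℕ) (F : Finset J) (s : ι) : Agree V F s s :=
  fun _ _ => rfl

open Classical in
/-- Number of points agreeing with `s` on `F`. -/
noncomputable def fib {ι J : Type*} [Fintype ι] (V : J → ι → ℕ) (F : Finset J) (s : ι) : ℝ :=
  ((Finset.univ.filter (fun s' => Agree V F s s')).card : ℝ)

lemma one_le_fib {ι J : Type*} [Fintype ι] (V : J → ι → ℕ) (F : Finset J) (s : ι) :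
    1 ≤ fib V F s := by
  classical
  unfold fib
  have : 0 < (Finset.univ.filter (fun s' => Agree V F s s')).card :=
    Finset.card_pos.mpr ⟨s, by simp [Agree.refl]⟩
  exact_mod_cast this

lemma fib_pos {ι J : Type*} [Fintype ι] (V : J → ι → ℕ) (F : Finset J) (s : ι) :
    0 < fib V F s := lt_of_lt_of_le one_pos (one_le_fib V F s)

lemma fib_anti {ι J : Type*} [Fintype ι] (V : J → ι → ℕ) {F G : Finset J} (h : F ⊆ G) (s : ι) :
    fib V G s ≤ fib V F s := by
  classical
  unfold fib
  norm_cast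
  apply Finset.card_le_card
  intro x hx
  simp only [Finset.mem_filter, Finset.mem_univ, true_and] at hx ⊢
  exact hx.mono h

lemma fib_eq_of_agree {ι J : Type*} [Fintype ι] (V : J → ι → ℕ) {F : Finset J} {s s' : ι}
    (h : Agree V F s s') : fib V F s' = fib V F s := by
  classical
  unfold fib
  congr 2
  ext x
  simp only [Finset.mem_filter, Finset.mem_univ, true_and]
  exact ⟨fun hx => h.trans hx, fun hx => h.symm.trans hx⟩

lemma fib_le_card {ι J : Type*} [Fintype ι] (V : J → ι → ℕ) (F : Finset J) (s : ι) :
    fib V F s ≤ Fintype.card ι := by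
  classical
  unfold fib
  norm_cast
  exact Finset.card_le_univ _

/-- Shannon entropy (uniform distribution) of the joint variable `F`. -/
noncomputable def ent {ι J : Type*} [Fintype ι] (V : J → ι → ℕ) (F : Finset J) : ℝ :=
  (∑ s, Real.log (Fintype.card ι / fib V F s)) / Fintype.card ι

open Classical in
lemma sum_inv_fib_le {ι J : Type*} [Fintype ι] (V : J → ι → ℕ) (F : Finset J) (D : Finset ι) :
    ∑ s ∈ D, (fib V F s)⁻¹ ≤ ((D.image (nm V F)).card : ℝ) := by
  rw [← Finset.sum_fiberwise_of_maps_to (t := D.image (nm V F)) (g := nm V F)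
    (fun x hx => Finset.mem_image_of_mem _ hx)]
  rw [← nsmul_one, ← Finset.sum_const]
  apply Finset.sum_le_sum
  intro b hb
  obtain ⟨s, hs, rfl⟩ := Finset.mem_image.mp hb
  have h1 : ∀ x ∈ D.filter (fun x => nm V F x = nm V F s), (fib V F x)⁻¹ = (fib V F s)⁻¹ := by
    intro x hx
    rw [Finset.mem_filter, nm_eq_iff] at hx
    rw [fib_eq_of_agree V hx.2]
  rw [Finset.sum_congr rfl h1, Finset.sum_const, nsmul_eq_mul]
  rw [← div_eq_mul_inv, div_le_one (fib_pos V F s)]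
  unfold fib
  norm_cast
  apply Finset.card_le_card
  intro x hx
  rw [Finset.mem_filter, nm_eq_iff] at hx
  simp [hx.2]

lemma ent_empty {ι J : Type*} [Fintype ι] [Nonempty ι] (V : J → ι → ℕ) : ent V ∅ = 0 := by
  classical
  have : ∀ s, fib V ∅ s = Fintype.card ι := by
    intro s
    unfold fib
    simp [Agree]
  unfold ent
  simp [this]

lemma ent_mono {ι J : Type*} [Fintype ι] [Nonempty ι] (V : J → ι → ℕ) {F G : Finset J}
    (h : F ⊆ G) : ent V F ≤ ent V G := by
  unfold ent
  have hc : (0 : ℝ) < Fintype.card ι := by exact_mod_cast Fintype.card_pos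
  apply div_le_div_of_nonneg_right _ hc.le
  apply Finset.sum_le_sum
  intro s _
  have h1 := fib_pos V F s
  have h2 := fib_pos V G s
  apply Real.log_le_log (by positivity)
  exact div_le_div_of_nonneg_left hc.le h2 (fib_anti V h s)

lemma ent_of_inj {ι J : Type*} [Fintype ι] [Nonempty ι] (V : J → ι → ℕ) {F : Finset J}
    (h : ∀ s s', Agree V F s s' → s = s') : ent V F = Real.log (Fintype.card ι) := by
  classical
  have hc : (0 : ℝ) < Fintype.card ι := by exact_mod_cast Fintype.card_pos
  have : ∀ s, fib V F s = 1 := by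
    intro s
    unfold fib
    norm_cast
    rw [Finset.card_eq_one]
    refine ⟨s, ?_⟩
    ext x
    simp only [Finset.mem_filter, Finset.mem_univ, true_and, Finset.mem_singleton]
    exact ⟨fun hx => (h _ _ hx).symm, fun hx => hx ▸ Agree.refl _ _ _⟩
  unfold ent
  simp only [this, div_one, Finset.sum_const, Finset.card_univ, nsmul_eq_mul]
  field_simp

open Classical in
lemma ent_submod {ι J : Type*} [Fintype ι] [Nonempty ι] [DecidableEq J] (V : J → ι → ℕ)
    (A B C : Finset J) (hA : C ⊆ A) (hB : C ⊆ B) :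
    ent V (A ∪ B) + ent V C ≤ ent V A + ent V B := by
  have hc : (0 : ℝ) < Fintype.card ι := by exact_mod_cast Fintype.card_pos
  unfold ent
  rw [← add_div, ← add_div]
  apply div_le_div_of_nonneg_right _ hc.le
  rw [← sub_nonpos, ← Finset.sum_add_distrib, ← Finset.sum_add_distrib, ← Finset.sum_sub_distrib]
  have key : ∑ s, fib V A s * fib V B s * (fib V (A ∪ B) s)⁻¹ * (fib V C s)⁻¹ ≤
      (Fintype.card ι : ℝ) := by
    have e1 : ∀ s, fib V A s * fib V B s * (fib V (A ∪ B) s)⁻¹ * (fib V C s)⁻¹ =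
        ∑ s1, ∑ s2, if Agree V A s s1 ∧ Agree V B s s2 then
          (fib V (A ∪ B) s)⁻¹ * (fib V C s)⁻¹ else 0 := by
      intro s
      have : ∀ s1, (∑ s2, if Agree V A s s1 ∧ Agree V B s s2 then
          (fib V (A ∪ B) s)⁻¹ * (fib V C s)⁻¹ else 0) =
          if Agree V A s s1 then fib V B s * ((fib V (A ∪ B) s)⁻¹ * (fib V C s)⁻¹) else 0 := by
        intro s1
        by_cases h : Agree V A s s1
        · simp only [h, true_and, if_true]
          rw [← Finset.sum_filter, Finset.sum_const, nsmul_eq_mul]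
          rfl
        · simp [h]
      simp only [this]
      rw [← Finset.sum_filter, Finset.sum_const, nsmul_eq_mul]
      change _ = fib V A s * _
      ring
    simp only [e1]
    rw [Finset.sum_comm]
    have e2 : ∀ s1, (∑ s, ∑ s2, if Agree V A s s1 ∧ Agree V B s s2 then
          (fib V (A ∪ B) s)⁻¹ * (fib V C s)⁻¹ else 0) ≤ 1 := by
      intro s1
      rw [Finset.sum_comm]
      have e3 : ∀ s2, (∑ s, if Agree V A s s1 ∧ Agree V B s s2 then
          (fib V (A ∪ B) s)⁻¹ * (fib V C s)⁻¹ else 0) ≤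
          if Agree V C s1 s2 then (fib V C s1)⁻¹ else 0 := by
        intro s2
        by_cases h : Agree V C s1 s2
        · simp only [h, if_true]
          rw [← Finset.sum_filter]
          have : ∀ s ∈ Finset.univ.filter (fun s => Agree V A s s1 ∧ Agree V B s s2),
              (fib V (A ∪ B) s)⁻¹ * (fib V C s)⁻¹ = (fib V (A ∪ B) s)⁻¹ * (fib V C s1)⁻¹ := by
            intro s hs
            rw [Finset.mem_filter] at hs
            rw [fib_eq_of_agree V (hs.2.1.mono hA)]
          rw [Finset.sum_congr rfl this, ← Finset.sum_mul]
          have h4 := sum_inv_fib_le V (A ∪ B)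
            (Finset.univ.filter (fun s => Agree V A s s1 ∧ Agree V B s s2))
          have h5 : ((Finset.univ.filter (fun s => Agree V A s s1 ∧ Agree V B s s2)).image
              (nm V (A ∪ B))).card ≤ 1 := by
            rw [Finset.card_le_one]
            intro a ha b hb
            obtain ⟨x, hx, rfl⟩ := Finset.mem_image.mp ha
            obtain ⟨y, hy, rfl⟩ := Finset.mem_image.mp hb
            rw [Finset.mem_filter] at hx hy
            rw [nm_eq_iff]
            intro j hj
            rcases Finset.mem_union.mp hj with hj | hj
            · rw [← hx.2.1 j hj, ← hy.2.1 j hj]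
            · rw [← hx.2.2 j hj, ← hy.2.2 j hj]
          have h6 : (((Finset.univ.filter (fun s => Agree V A s s1 ∧ Agree V B s s2)).image
              (nm V (A ∪ B))).card : ℝ) ≤ 1 := by exact_mod_cast h5
          have h7 : 0 ≤ (fib V C s1)⁻¹ := inv_nonneg.mpr (fib_pos _ _ _).le
          calc _ ≤ 1 * (fib V C s1)⁻¹ := mul_le_mul_of_nonneg_right (h4.trans h6) h7
            _ = _ := one_mul _
        · simp only [h, if_false]
          apply le_of_eq
          apply Finset.sum_eq_zero
          intro s _
          rw [if_neg]
          rintro ⟨h1, h2⟩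
          exact h ((h1.mono hA).symm.trans (h2.mono hB))
      refine (Finset.sum_le_sum (fun s2 _ => e3 s2)).trans ?_
      rw [← Finset.sum_filter, Finset.sum_const, nsmul_eq_mul]
      change fib V C s1 * _ ≤ 1
      rw [mul_inv_cancel₀ (fib_pos _ _ _).ne']
    refine (Finset.sum_le_sum (fun s1 _ => e2 s1)).trans ?_
    simp
  have step : ∀ s, (Real.log (Fintype.card ι / fib V (A ∪ B) s) + Real.log (Fintype.card ι / fib V C s)
      - (Real.log (Fintype.card ι / fib V A s) + Real.log (Fintype.card ι / fib V B s))) ≤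
      fib V A s * fib V B s * (fib V (A ∪ B) s)⁻¹ * (fib V C s)⁻¹ - 1 := by
    intro s
    have a1 := fib_pos V A s
    have a2 := fib_pos V B s
    have a3 := fib_pos V (A ∪ B) s
    have a4 := fib_pos V C s
    have := Real.log_le_sub_one_of_pos
      (show 0 < fib V A s * fib V B s * (fib V (A ∪ B) s)⁻¹ * (fib V C s)⁻¹ by positivity)
    rw [Real.log_mul (by positivity) (by positivity), Real.log_mul (by positivity) (by positivity),
      Real.log_mul (by positivity) (by positivity), Real.log_inv, Real.log_inv] at this
    rw [Real.log_div hc.ne' a1.ne', Real.log_div hc.ne' a2.ne', Real.log_div hc.ne' a3.ne',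
      Real.log_div hc.ne' a4.ne']
    linarith
  refine (Finset.sum_le_sum (fun s _ => step s)).trans ?_
  rw [Finset.sum_sub_distrib]
  simp only [Finset.sum_const, Finset.card_univ, nsmul_eq_mul, mul_one]
  linarith

open Classical in
lemma ent_cond_le {ι J β : Type*} [Fintype ι] [Nonempty ι] [DecidableEq J] (V : J → ι → ℕ)
    (P F : Finset J) (y : ι → β)
    (hy : ∀ s s', y s' = y s → Agree V F s s')
    (W : Finset ι) (b m : ℝ) (hb : 0 < b) (hm : 0 < m)
    (hB : ∀ s, (((W.filter (fun s' => Agree V P s s')).image y).card : ℝ) ≤ b)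
    (hM : ∀ s, (((Finset.univ.filter (fun s' => Agree V P s s')).image y).card : ℝ) ≤ m) :
    ent V (P ∪ F) - ent V P ≤ Real.log 2 + (W.card / Fintype.card ι : ℝ) * Real.log b
      + (1 - W.card / Fintype.card ι : ℝ) * Real.log m := by
  have hc : (0 : ℝ) < Fintype.card ι := by exact_mod_cast Fintype.card_pos
  have gen : ∀ (D : Finset ι) (r : ℝ),
      (∀ s, (((D.filter (fun s' => Agree V P s s')).image y).card : ℝ) ≤ r) →
      ∑ s ∈ D, fib V P s * (fib V (P ∪ F) s)⁻¹ ≤ Fintype.card ι * r := by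
    intro D r hr
    have e1 : ∀ s, fib V P s * (fib V (P ∪ F) s)⁻¹ =
        ∑ s', if Agree V P s' s then (fib V (P ∪ F) s)⁻¹ else 0 := by
      intro s
      rw [← Finset.sum_filter, Finset.sum_const, nsmul_eq_mul]
      congr 1
      unfold fib
      congr 2
      ext x
      simp only [Finset.mem_filter, Finset.mem_univ, true_and]
      exact ⟨Agree.symm, Agree.symm⟩
    simp only [e1]
    rw [Finset.sum_comm]
    rw [← Finset.card_univ, ← nsmul_eq_mul, ← Finset.sum_const]
    apply Finset.sum_le_sum
    intro s' _
    rw [← Finset.sum_filter]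
    refine (sum_inv_fib_le V (P ∪ F) _).trans (le_trans ?_ (hr s'))
    norm_cast
    set E := D.filter (fun s'' => Agree V P s' s'') with hE
    have : (E.image (nm V (P ∪ F))).card ≤ (E.image y).card := by
      apply Finset.card_le_card_of_injOn
        (fun z => if h : ∃ x ∈ E, nm V (P ∪ F) x = z then y h.choose else y s')
      · intro z hz
        have h : ∃ x ∈ E, nm V (P ∪ F) x = z := by
          simpa using hz
        simp only [h, dif_pos]
        exact Finset.mem_coe.mpr (Finset.mem_image_of_mem _ h.choose_spec.1)
      · intro z hz z' hz' hzz
        have h : ∃ x ∈ E, nm V (P ∪ F) x = z := by simpa using hz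
        have h' : ∃ x ∈ E, nm V (P ∪ F) x = z' := by simpa using hz'
        simp only [h, h', dif_pos] at hzz
        rw [← h.choose_spec.2, ← h'.choose_spec.2, nm_eq_iff]
        have kE : ∀ x ∈ E, Agree V P s' x := fun x hx => (Finset.mem_filter.mp hx).2
        have k1 := kE _ h.choose_spec.1
        have k2 := kE _ h'.choose_spec.1
        have k3 := hy _ _ hzz
        intro j hj
        rcases Finset.mem_union.mp hj with hj | hj
        · exact (k2.symm.trans k1) j hj
        · exact k3 j hj
    exact this
  have h1 := gen W b hB
  have h2 := gen Finset.univ m hM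
  have h2' : ∑ s ∈ Wᶜ, fib V P s * (fib V (P ∪ F) s)⁻¹ ≤ Fintype.card ι * m := by
    refine le_trans (Finset.sum_le_sum_of_subset_of_nonneg (Finset.subset_univ _) ?_) h2
    intro i _ _
    have := fib_pos V P i
    have := fib_pos V (P ∪ F) i
    positivity
  have e : ent V (P ∪ F) - ent V P =
      (∑ s, Real.log (fib V P s * (fib V (P ∪ F) s)⁻¹)) / Fintype.card ι := by
    unfold ent
    rw [← sub_div, ← Finset.sum_sub_distrib]
    congr 1
    apply Finset.sum_congr rfl
    intro s _
    have a1 := fib_pos V P s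
    have a2 := fib_pos V (P ∪ F) s
    rw [Real.log_div hc.ne' a1.ne', Real.log_div hc.ne' a2.ne', Real.log_mul a1.ne' (by positivity),
      Real.log_inv]
    ring
  have st : ∀ (D : Finset ι) (r : ℝ), 0 < r →
      ∑ s ∈ D, fib V P s * (fib V (P ∪ F) s)⁻¹ ≤ Fintype.card ι * r →
      ∑ s ∈ D, Real.log (fib V P s * (fib V (P ∪ F) s)⁻¹) ≤
        D.card * (Real.log 2 + Real.log r) + Fintype.card ι / 2 - D.card := by
    intro D r hr hD
    have : ∀ s ∈ D, Real.log (fib V P s * (fib V (P ∪ F) s)⁻¹) ≤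
        (Real.log 2 + Real.log r) + (fib V P s * (fib V (P ∪ F) s)⁻¹) * (2 * r)⁻¹ - 1 := by
      intro s _
      have a1 := fib_pos V P s
      have a2 := fib_pos V (P ∪ F) s
      have := Real.log_le_sub_one_of_pos
        (show 0 < (fib V P s * (fib V (P ∪ F) s)⁻¹) * (2 * r)⁻¹ by positivity)
      rw [Real.log_mul (by positivity) (by positivity), Real.log_inv,
        Real.log_mul (by norm_num) hr.ne'] at this
      linarith
    refine (Finset.sum_le_sum this).trans ?_
    rw [Finset.sum_sub_distrib, Finset.sum_add_distrib, ← Finset.sum_mul]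
    simp only [Finset.sum_const, nsmul_eq_mul, mul_one]
    have : (∑ s ∈ D, fib V P s * (fib V (P ∪ F) s)⁻¹) * (2 * r)⁻¹ ≤ Fintype.card ι / 2 := by
      calc _ ≤ (Fintype.card ι * r) * (2 * r)⁻¹ :=
            mul_le_mul_of_nonneg_right hD (by positivity)
        _ = _ := by field_simp
    linarith
  rw [e]
  have s1 := st W b hb h1
  have s2 := st Wᶜ m hm h2'
  have hcard : ((Wᶜ.card : ℕ) : ℝ) = Fintype.card ι - W.card := by
    rw [Finset.card_compl, Nat.cast_sub (Finset.card_le_univ _)]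
  rw [hcard] at s2
  rw [← Finset.sum_add_sum_compl W, div_le_iff₀ hc]
  have : (Real.log 2 + (W.card / Fintype.card ι : ℝ) * Real.log b
      + (1 - W.card / Fintype.card ι : ℝ) * Real.log m) * Fintype.card ι =
      Fintype.card ι * Real.log 2 + W.card * Real.log b
       + (Fintype.card ι - W.card) * Real.log m := by
    field_simp
  rw [this]
  linarith

end DC2

namespace DC2

/-! ### Stationary polymatroids -/

/-- Time shift of a finite set of (level, time) indices. -/
def sh (a : ℕ) (F : Finset (ℕ × ℕ)) : Finset (ℕ × ℕ) := F.image (fun p => (p.1, p.2 + a))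

/-- The block of all levels `< q` and times in `[l, r)`. -/
def Blk (q l r : ℕ) : Finset (ℕ × ℕ) := Finset.range q ×ˢ Finset.Ico l r

lemma mem_Blk {q l r : ℕ} {p : ℕ × ℕ} : p ∈ Blk q l r ↔ p.1 < q ∧ l ≤ p.2 ∧ p.2 < r := by
  simp [Blk]

lemma sh_Blk (a q l r : ℕ) : sh a (Blk q l r) = Blk q (l + a) (r + a) := by
  ext ⟨k, n⟩
  simp only [sh, Finset.mem_image, mem_Blk, Prod.mk.injEq, Prod.exists]
  constructor
  · rintro ⟨k', n', h, rfl, rfl⟩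
    omega
  · intro h
    exact ⟨k, n - a, by omega, rfl, by omega⟩

lemma sh_union (a : ℕ) (F G : Finset (ℕ × ℕ)) : sh a (F ∪ G) = sh a F ∪ sh a G := by
  simp [sh, Finset.image_union]

lemma sh_sh (a b : ℕ) (F : Finset (ℕ × ℕ)) : sh a (sh b F) = sh (b + a) F := by
  simp only [sh, Finset.image_image]
  congr 1
  funext p
  simp [add_assoc]

lemma sh_zero (F : Finset (ℕ × ℕ)) : sh 0 F = F := by
  simp [sh]

lemma sh_mono (a : ℕ) {F G : Finset (ℕ × ℕ)} (h : F ⊆ G) : sh a F ⊆ sh a G :=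
  Finset.image_subset_image h

/-- A stationary polymatroid. -/
structure Poly (H : Finset (ℕ × ℕ) → ℝ) : Prop where
  empty : H ∅ = 0
  mono : ∀ A B, A ⊆ B → H A ≤ H B
  sub : ∀ A B C, C ⊆ A → C ⊆ B → H (A ∪ B) + H C ≤ H A + H B
  shift : ∀ a A, H (sh a A) = H A

/-- Conditional mutual information `I(A ; E | D)`. -/
def cmi (H : Finset (ℕ × ℕ) → ℝ) (A E D : Finset (ℕ × ℕ)) : ℝ :=
  H (A ∪ D) + H (E ∪ D) - H (A ∪ E ∪ D) - H D

section
variable {H : Finset (ℕ × ℕ) → ℝ}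

lemma Poly.subadd (hH : Poly H) (A B : Finset (ℕ × ℕ)) : H (A ∪ B) ≤ H A + H B := by
  have := hH.sub A B ∅ (Finset.empty_subset _) (Finset.empty_subset _)
  rw [hH.empty] at this
  linarith

/-- General comparison: conditional entropy decreases when conditioning more. -/
lemma Poly.cond (hH : Poly H) (E D D' : Finset (ℕ × ℕ)) (h : D ⊆ D') :
    H (E ∪ D') - H D' ≤ H (E ∪ D) - H D := by
  have := hH.sub (E ∪ D) D' D Finset.subset_union_right h
  have e : E ∪ D ∪ D' = E ∪ D' := by
    rw [Finset.union_assoc, Finset.union_eq_right.mpr h]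
  rw [e] at this
  linarith

lemma Poly.cmi_mono (hH : Poly H) (A A' E E' D : Finset (ℕ × ℕ)) (hA : A ⊆ A') (hE : E ⊆ E') :
    cmi H A E D ≤ cmi H A' E' D := by
  have h1 := hH.cond E (A ∪ D) (A' ∪ D) (Finset.union_subset_union_left hA)
  have h2 := hH.cond A' (E ∪ D) (E' ∪ D) (Finset.union_subset_union_left hE)
  have e1 : E ∪ (A ∪ D) = A ∪ E ∪ D := by
    ext x; simp only [Finset.mem_union]; tauto
  have e2 : E ∪ (A' ∪ D) = A' ∪ E ∪ D := by
    ext x; simp only [Finset.mem_union]; tauto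
  rw [e1, e2] at h1
  rw [← Finset.union_assoc, ← Finset.union_assoc] at h2
  unfold cmi
  linarith

lemma cmi_shift (hH : Poly H) (a : ℕ) (A E D : Finset (ℕ × ℕ)) :
    cmi H (sh a A) (sh a E) (sh a D) = cmi H A E D := by
  unfold cmi
  rw [← sh_union, ← sh_union, ← sh_union, ← sh_union, hH.shift, hH.shift, hH.shift, hH.shift]

/-- Entropy of the block of length `n` at levels `< q`. -/
def blkEnt (H : Finset (ℕ × ℕ) → ℝ) (q n : ℕ) : ℝ := H (Blk q 0 n)

lemma Poly.H_Blk (hH : Poly H) (q l r : ℕ) (h : l ≤ r) : H (Blk q l r) = blkEnt H q (r - l) := by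
  have := hH.shift l (Blk q 0 (r - l))
  rw [sh_Blk] at this
  rw [blkEnt, ← this]
  congr 2
  · omega
  · omega

lemma Blk_union (q l m r : ℕ) (h1 : l ≤ m) (h2 : m ≤ r) : Blk q l m ∪ Blk q m r = Blk q l r := by
  ext p
  simp only [Finset.mem_union, mem_Blk]
  omega

lemma Poly.incr_anti (hH : Poly H) (q : ℕ) :
    Antitone (fun n => blkEnt H q (n + 1) - blkEnt H q n) := by
  apply antitone_nat_of_succ_le
  intro n
  have h := hH.sub (Blk q 0 (n + 1)) (Blk q 1 (n + 2)) (Blk q 1 (n + 1))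
    (by intro p; simp only [mem_Blk]; omega) (by intro p; simp only [mem_Blk]; omega)
  have e : Blk q 0 (n + 1) ∪ Blk q 1 (n + 2) = Blk q 0 (n + 2) := by
    ext p; simp only [Finset.mem_union, mem_Blk]; omega
  rw [e, hH.H_Blk q 0 (n+2) (by omega), hH.H_Blk q 1 (n+1) (by omega),
    hH.H_Blk q 0 (n+1) (by omega), hH.H_Blk q 1 (n+2) (by omega)] at h
  have e1 : n + 2 - 0 = n + 1 + 1 := by omega
  have e2 : n + 1 - 1 = n := by omega
  have e3 : n + 1 - 0 = n + 1 := by omega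
  have e4 : n + 2 - 1 = n + 1 := by omega
  rw [e1, e2, e3, e4] at h
  linarith

lemma Poly.incr_nonneg (hH : Poly H) (q n : ℕ) : 0 ≤ blkEnt H q (n + 1) - blkEnt H q n := by
  rw [sub_nonneg]
  apply hH.mono
  intro p; simp only [mem_Blk]; omega

/-- The excess function: sublinear bound on the information between past and future. -/
lemma Poly.excess (hH : Poly H) (q : ℕ) :
    ∃ e : ℕ → ℝ, Tendsto (fun n => e n / n) atTop (nhds 0) ∧
      ∀ n R, n ≤ R → cmi H (Blk q 0 n) (Blk q n R) ∅ ≤ e n := by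
  set d : ℕ → ℝ := fun n => blkEnt H q (n + 1) - blkEnt H q n with hd
  have hb : BddBelow (Set.range d) := ⟨0, by rintro _ ⟨n, rfl⟩; exact hH.incr_nonneg q n⟩
  have hlim := tendsto_atTop_ciInf (hH.incr_anti q) hb
  set c := ⨅ n, d n with hcdef
  have h0 : blkEnt H q 0 = 0 := by
    have : Blk q 0 0 = ∅ := by ext p; simp [mem_Blk]
    rw [blkEnt, this, hH.empty]
  have hsum : ∀ n, ∑ i ∈ Finset.range n, d i = blkEnt H q n := by
    intro n
    rw [Finset.sum_range_sub, h0, sub_zero]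
  refine ⟨fun n => blkEnt H q n - n * c, ?_, ?_⟩
  · have h1 := hlim.cesaro
    have h2 : Tendsto (fun n : ℕ => (n : ℝ)⁻¹ * ∑ i ∈ Finset.range n, d i - c) atTop
        (nhds (c - c)) := h1.sub_const c
    rw [sub_self] at h2
    refine h2.congr' ?_
    filter_upwards [eventually_gt_atTop 0] with n hn
    have : (n : ℝ) ≠ 0 := by positivity
    rw [hsum]
    field_simp
  · intro n R hR
    have hge : ∀ k, blkEnt H q (n + k) - blkEnt H q k ≥ n * c := by
      intro k
      have : blkEnt H q (n + k) - blkEnt H q k = ∑ i ∈ Finset.range n, d (k + i) := by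
        rw [← hsum, ← hsum, add_comm n k, Finset.sum_range_add, add_sub_cancel_left]
      rw [this]
      have : ∑ i ∈ Finset.range n, c ≤ ∑ i ∈ Finset.range n, d (k + i) :=
        Finset.sum_le_sum (fun i _ => ciInf_le hb _)
      simpa using this
    have := hge (R - n)
    unfold cmi
    simp only [Finset.union_empty]
    rw [Blk_union q 0 n R (by omega) hR, hH.empty, hH.H_Blk q 0 R (by omega),
      hH.H_Blk q 0 n (by omega), hH.H_Blk q n R hR, Nat.sub_zero, Nat.sub_zero]
    rw [Nat.add_sub_cancel' hR] at this
    linarith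

/-- Refining the far future costs little information about a fixed block. -/
lemma Poly.future (hH : Poly H) (q q' b : ℕ) (hq : q ≤ q') (hb : 0 < b) (η : ℝ) (hη : 0 < η) :
    ∀ᶠ n in atTop, ∀ R, n ≤ R → cmi H (Blk q 0 b) (Blk q' n R) (Blk q b n) ≤ η := by
  obtain ⟨e, he, hI⟩ := hH.excess q'
  -- information is antitone in n
  have hanti : ∀ n n' R, b ≤ n → n ≤ n' → n' ≤ R →
      cmi H (Blk q 0 b) (Blk q' n' R) (Blk q b n') ≤ cmi H (Blk q 0 b) (Blk q' n R) (Blk q b n) := by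
    intro n n' R h0 h1 h2
    have a1 := hH.cond (Blk q 0 b) (Blk q b n) (Blk q b n') (by
      intro p; simp only [mem_Blk]; omega)
    have a2 := hH.cond (Blk q 0 b) (Blk q' n' R ∪ Blk q b n') (Blk q' n R ∪ Blk q b n) (by
      intro p; simp only [Finset.mem_union, mem_Blk]; omega)
    rw [← Finset.union_assoc, ← Finset.union_assoc] at a2
    unfold cmi
    linarith
  have hchain : ∀ t R, t * b ≤ R →
      t * cmi H (Blk q 0 b) (Blk q' (t * b) R) (Blk q b (t * b)) ≤ e (t * b) := by
    intro t R hR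
    set R' := R + t * b with hR'
    refine le_trans ?_ (hI (t * b) R' (by omega))
    refine le_trans ?_ (hH.cmi_mono (Blk q 0 (t * b)) _ (Blk q' (t * b) R') _ ∅ (by
      intro p; simp only [mem_Blk]; omega) (Finset.Subset.refl _))
    -- chain rule
    set E := Blk q' (t * b) R' with hE
    have tele : ∑ i ∈ Finset.range t, cmi H (Blk q (i * b) ((i + 1) * b)) E
        (Blk q ((i + 1) * b) (t * b)) = cmi H (Blk q 0 (t * b)) E ∅ := by
      set g : ℕ → ℝ := fun i => H (Blk q (i * b) (t * b)) - H (Blk q (i * b) (t * b) ∪ E) with hg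
      have : ∀ i ∈ Finset.range t, cmi H (Blk q (i * b) ((i + 1) * b)) E
        (Blk q ((i + 1) * b) (t * b)) = g i - g (i + 1) := by
        intro i hi
        rw [Finset.mem_range] at hi
        have l1 : i * b ≤ (i + 1) * b := Nat.mul_le_mul_right _ (by omega)
        have l2 : (i + 1) * b ≤ t * b := Nat.mul_le_mul_right _ (by omega)
        unfold cmi
        simp only [hg]
        rw [Blk_union _ _ _ _ l1 l2]
        have e1 : Blk q (i * b) ((i + 1) * b) ∪ E ∪ Blk q ((i + 1) * b) (t * b)
            = Blk q (i * b) (t * b) ∪ E := by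
          rw [← Blk_union _ _ _ _ l1 l2]
          ext x; simp only [Finset.mem_union]; tauto
        rw [e1, Finset.union_comm E]
        ring
      rw [Finset.sum_congr rfl this, Finset.sum_range_sub' g]
      simp only [hg]
      have z : Blk q (t * b) (t * b) = ∅ := by
        ext p; simp only [mem_Blk]; simp
      rw [z]
      unfold cmi
      simp only [Finset.union_empty, Finset.empty_union, zero_mul]
      rw [hH.empty]; ring
    rw [← tele]
    rw [← nsmul_eq_mul, ← Finset.card_range t, ← Finset.sum_const]
    simp only [Finset.card_range]
    apply Finset.sum_le_sum
    intro i hi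
    rw [Finset.mem_range] at hi
    have l2 : (i + 1) * b ≤ t * b := Nat.mul_le_mul_right _ (by omega)
    have l3 : (i + 1) * b = i * b + b := by ring
    have e2 : cmi H (Blk q (i * b) ((i + 1) * b)) E (Blk q ((i + 1) * b) (t * b)) =
        cmi H (Blk q 0 b) (Blk q' (t * b - i * b) (R' - i * b)) (Blk q b (t * b - i * b)) := by
      rw [← cmi_shift hH (i * b) (Blk q 0 b), sh_Blk, sh_Blk, sh_Blk, hE]
      have q1 : 0 + i * b = i * b := by omega
      have q2 : b + i * b = (i + 1) * b := by omega
      have q3 : t * b - i * b + i * b = t * b := by omega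
      have q4 : R' - i * b + i * b = R' := by omega
      rw [q1, q2, q3, q4]
    rw [e2]
    refine le_trans ?_ (hanti _ (t * b) _ (by omega) (by omega) (by omega))
    apply hH.cmi_mono _ _ _ _ _ (Finset.Subset.refl _)
    intro p; simp only [mem_Blk]; omega
  -- find t
  have hb' : (0 : ℝ) < b := by exact_mod_cast hb
  have hsub : Tendsto (fun t : ℕ => t * b) atTop atTop :=
    tendsto_id.atTop_mul_const' hb
  have ht := (he.comp hsub).eventually (gt_mem_nhds (show (0 : ℝ) < η / b by positivity))
  obtain ⟨t, ht1, ht2⟩ := (ht.and (eventually_gt_atTop 0)).exists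
  filter_upwards [eventually_ge_atTop (t * b)] with n hn R hR
  have hbt : b ≤ t * b := Nat.le_mul_of_pos_left b ht2
  refine (hanti (t * b) n R hbt hn hR).trans ?_
  have h3 := hchain t R (by omega)
  have ht2' : (0 : ℝ) < t := by exact_mod_cast ht2
  simp only [Function.comp] at ht1
  push_cast at ht1
  rw [div_lt_div_iff₀ (by positivity) hb'] at ht1
  have h4 : e (t * b) < η * t := by
    by_contra hcon
    push Not at hcon
    nlinarith
  have h5 : t * cmi H (Blk q 0 b) (Blk q' (t * b) R) (Blk q b (t * b)) < t * η := by linarith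
  exact (lt_of_mul_lt_mul_left h5 ht2'.le).le

/-- Conditional entropy of level-zero block given any future. -/
lemma Poly.cond_future (hH : Poly H) (h : ℝ) (hY : ∀ n : ℕ, h * n ≤ H (Blk 1 0 n))
    (q : ℕ) (hq : 1 ≤ q) (η : ℝ) (hη : 0 < η) :
    ∀ᶠ n in atTop, ∀ R, n ≤ R →
      (h - η) * n ≤ H (Blk 1 0 n ∪ Blk q n R) - H (Blk q n R) := by
  obtain ⟨e, he, hI⟩ := hH.excess q
  filter_upwards [he.eventually (gt_mem_nhds hη), eventually_gt_atTop 0] with n hn hn0 R hR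
  have h1 := hI n R hR
  have h2 := hH.cmi_mono (Blk 1 0 n) (Blk q 0 n) (Blk q n R) (Blk q n R) ∅ (by
      intro p; simp only [mem_Blk]; omega) (Finset.Subset.refl _)
  have hn' : (0 : ℝ) < n := by exact_mod_cast hn0
  rw [div_lt_iff₀ hn'] at hn
  have h3 := hY n
  have h4 : cmi H (Blk 1 0 n) (Blk q n R) ∅ =
      H (Blk 1 0 n) + H (Blk q n R) - H (Blk 1 0 n ∪ Blk q n R) := by
    unfold cmi
    simp only [Finset.union_empty]
    rw [hH.empty]; ring
  rw [h4] at h2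
  linarith

end

end DC2

namespace DC2

/-! ### Choice of the time scales -/

/-- End of the `j`-th proximality block. -/
def mm (n : ℕ → ℕ) (j : ℕ) : ℕ := (j + 2) * n j

/-- Indices of the `j`-th proximality block. -/
def Cl (n : ℕ → ℕ) (j : ℕ) : Finset (ℕ × ℕ) := {j + 1} ×ˢ Finset.Ico (n j) (mm n j)

/-- Indices of the `j`-th separation block. -/
def Fs (n : ℕ → ℕ) (j : ℕ) : Finset (ℕ × ℕ) := Blk 1 (mm n j) (n (j + 1))

/-- Past of the `k`-th separation block, together with all proximality blocks up to `L`. -/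
def Ps (n : ℕ → ℕ) (L k : ℕ) : Finset (ℕ × ℕ) :=
  (Finset.range L).biUnion (Cl n) ∪ (Finset.range k).biUnion (Fs n)

lemma Ps_succ (n : ℕ → ℕ) (L k : ℕ) : Ps n L (k + 1) = Ps n L k ∪ Fs n k := by
  unfold Ps
  rw [Finset.range_add_one, Finset.biUnion_insert, Finset.union_comm (Fs n k),
    ← Finset.union_assoc]

/-- Union of fine blocks used to dominate the future. -/
def Ds (n : ℕ → ℕ) (k i : ℕ) : Finset (ℕ × ℕ) :=
  (Finset.Ico (k + 1) i).biUnion (fun j => Blk (j + 2) (n j) (n (j + 1)))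

lemma exists_scales {H : Finset (ℕ × ℕ) → ℝ} (hH : Poly H) (h : ℝ)
    (hY : ∀ n : ℕ, h * n ≤ H (Blk 1 0 n)) (θ : ℝ) (hθ : 0 < θ) (hθh : 3 * θ ≤ h)
    (Ex : ℕ → ℕ → ℕ → Prop) (hEx : ∀ j b, ∀ᶠ n in atTop, Ex j b n) :
    ∃ n : ℕ → ℕ, (∀ j, 0 < n j) ∧ (∀ j, mm n j < n (j + 1)) ∧ (∀ j, Ex j (n j) (n (j + 1))) ∧
      ∀ L k, k < L → (h - 3 * (θ * (1 / 2) ^ k)) * ((n (k + 1) - mm n k : ℕ) : ℝ) ≤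
        H (Ps n L k ∪ Fs n k) - H (Ps n L k) := by
  set η : ℕ → ℝ := fun k => θ * (1 / 2) ^ k with hη
  have hηpos : ∀ k, 0 < η k := fun k => by simp only [hη]; positivity
  have ev : ∀ j b, 0 < b → ∃ n, (j + 2) * b < n ∧ Ex j b n ∧
      (∀ R, n ≤ R → cmi H (Blk (j + 2) 0 b) (Blk (j + 3) n R) (Blk (j + 2) b n) ≤ η j) ∧
      (∀ R, n ≤ R → (h - η j) * n ≤ H (Blk 1 0 n ∪ Blk (j + 3) n R) - H (Blk (j + 3) n R)) ∧
      H (Blk (j + 2) 0 ((j + 2) * b)) ≤ η j * n := by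
    intro j b hb
    have a1 := hH.future (j + 2) (j + 3) b (by omega) hb (η j) (hηpos j)
    have a2 := hH.cond_future h hY (j + 3) (by omega) (η j) (hηpos j)
    have a3 : Tendsto (fun n : ℕ => η j * (n : ℝ)) atTop atTop :=
      tendsto_natCast_atTop_atTop.const_mul_atTop (hηpos j)
    have a4 := a3.eventually_ge_atTop (H (Blk (j + 2) 0 ((j + 2) * b)))
    obtain ⟨n, h1, h2, h3, h4, h5⟩ :=
      (a1.and (a2.and (a4.and ((hEx j b).and (eventually_gt_atTop ((j + 2) * b)))))).exists
    exact ⟨n, h5, h4, h1, h2, h3⟩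
  choose! f hf using ev
  let n : ℕ → ℕ := fun j => Nat.rec 1 (fun j b => f j b) j
  have n_succ : ∀ j, n (j + 1) = f j (n j) := fun j => rfl
  have npos : ∀ j, 0 < n j := by
    intro j
    induction j with
    | zero => exact one_pos
    | succ j ih =>
      rw [n_succ]
      have := (hf j (n j) ih).1
      omega
  have hm : ∀ j, mm n j < n (j + 1) := fun j => (hf j (n j) (npos j)).1
  have hnm : ∀ j, n j ≤ mm n j := fun j => by
    unfold mm; exact Nat.le_mul_of_pos_left _ (by omega)
  have nmono : Monotone n := monotone_nat_of_le_succ (fun j => (hnm j).trans (hm j).le)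
  refine ⟨n, npos, hm, fun j => (hf j (n j) (npos j)).2.1, ?_⟩
  intro L k hkL
  set B := Blk 1 0 (n (k + 1)) with hB
  have key : ∀ i, k + 1 ≤ i → i ≤ L →
      (h - η k) * (n (k + 1) : ℝ) - (η k - θ * (1 / 2) ^ (i - 1)) ≤
        H (B ∪ (Ds n k i ∪ Blk (i + 2) (n i) (n L))) - H (Ds n k i ∪ Blk (i + 2) (n i) (n L)) := by
    intro i hi
    induction i, hi using Nat.le_induction with
    | base =>
      intro hL
      have e : Ds n k (k + 1) = ∅ := by simp [Ds]
      rw [e, Finset.empty_union]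
      have := (hf k (n k) (npos k)).2.2.2.1 (n L) (nmono hL)
      rw [← n_succ] at this
      simp only [hη, Nat.add_sub_cancel] at this ⊢
      linarith
    | succ i hi ih =>
      intro hL
      have ih' := ih (by omega)
      have c := (hf i (n i) (npos i)).2.2.1 (n L) (nmono hL)
      rw [← n_succ] at c
      set M := Blk (i + 2) (n i) (n (i + 1)) with hM
      set E := Blk (i + 3) (n (i + 1)) (n L) with hE
      set D := Ds n k i with hD
      have eD : Ds n k (i + 1) = D ∪ M := by
        rw [hD, hM]
        unfold Ds
        rw [← Finset.insert_Ico_right_eq_Ico_add_one hi, Finset.biUnion_insert, Finset.union_comm]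
      rw [eD]
      have s0 : H (B ∪ (D ∪ Blk (i + 2) (n i) (n L))) - H (D ∪ Blk (i + 2) (n i) (n L)) ≤
          H (B ∪ (D ∪ M)) - H (D ∪ M) := by
        apply hH.cond
        apply Finset.union_subset_union_right
        have := nmono hL
        intro p; simp only [hM, mem_Blk]; omega
      have sub1 : B ∪ D ⊆ Blk (i + 2) 0 (n i) := by
        apply Finset.union_subset
        · have := nmono hi
          intro p; simp only [hB, mem_Blk]; omega
        · rw [hD]
          unfold Ds
          rw [Finset.biUnion_subset]
          intro j hj
          rw [Finset.mem_Ico] at hj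
          have := nmono (show j + 1 ≤ i by omega)
          intro p; simp only [mem_Blk]; omega
      have s1 := hH.cond E M (D ∪ M) Finset.subset_union_right
      have s2 := hH.cond E (B ∪ D ∪ M) (Blk (i + 2) 0 (n i) ∪ M)
        (Finset.union_subset_union_left sub1)
      unfold cmi at c
      have e1 : E ∪ (B ∪ D ∪ M) = B ∪ (D ∪ M ∪ E) := by
        ext x; simp only [Finset.mem_union]; tauto
      have e2 : E ∪ (Blk (i + 2) 0 (n i) ∪ M) = Blk (i + 2) 0 (n i) ∪ E ∪ M := by
        ext x; simp only [Finset.mem_union]; tauto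
      have e3 : E ∪ (D ∪ M) = D ∪ M ∪ E := Finset.union_comm _ _
      have e4 : B ∪ D ∪ M = B ∪ (D ∪ M) := Finset.union_assoc _ _ _
      rw [e1, e2, e4] at s2
      rw [e3] at s1
      have hpow : θ * (1 / 2 : ℝ) ^ (i - 1) = 2 * (θ * (1 / 2) ^ i) := by
        obtain ⟨i', rfl⟩ : ∃ i', i = i' + 1 := ⟨i - 1, by omega⟩
        simp only [Nat.add_sub_cancel, pow_succ]
        ring
      rw [hpow] at ih'
      simp only [Nat.add_sub_cancel]
      simp only [hη] at c ih' ⊢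
      change _ ≤ H (B ∪ (D ∪ M ∪ E)) - H (D ∪ M ∪ E)
      linarith
  have fin := key L hkL le_rfl
  have eL : Blk (L + 2) (n L) (n L) = ∅ := by
    ext p; simp only [mem_Blk]; simp
  rw [eL, Finset.union_empty] at fin
  set Pa := Blk (k + 2) 0 (mm n k) with hPa
  have hPaH : H Pa ≤ η k * n (k + 1) := (hf k (n k) (npos k)).2.2.2.2
  set Fu := Ds n k L with hFu
  have mmono : Monotone (mm n) := fun a b hab => by
    unfold mm
    exact Nat.mul_le_mul (by omega) (nmono hab)
  have sub2 : Ps n L k ⊆ Pa ∪ Fu := by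
    unfold Ps
    apply Finset.union_subset
    · rw [Finset.biUnion_subset]
      intro j hj
      rw [Finset.mem_range] at hj
      by_cases hjk : j ≤ k
      · apply Finset.Subset.trans _ Finset.subset_union_left
        have := mmono hjk
        intro p
        simp only [Cl, Finset.mem_product, Finset.mem_singleton, Finset.mem_Ico, hPa, mem_Blk]
        omega
      · apply Finset.Subset.trans _ Finset.subset_union_right
        apply Finset.Subset.trans _ (Finset.subset_biUnion_of_mem
          (fun j => Blk (j + 2) (n j) (n (j + 1))) (show j ∈ Finset.Ico (k + 1) L by
            rw [Finset.mem_Ico]; omega))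
        have := hm j
        intro p
        simp only [Cl, Finset.mem_product, Finset.mem_singleton, Finset.mem_Ico, mem_Blk]
        omega
    · apply Finset.Subset.trans _ Finset.subset_union_left
      rw [Finset.biUnion_subset]
      intro j hj
      rw [Finset.mem_range] at hj
      have := nmono (show j + 1 ≤ k by omega)
      have := hnm k
      intro p; simp only [Fs, hPa, mem_Blk]; omega
  have t1 := hH.cond (Fs n k) (Ps n L k) (Pa ∪ Fu) sub2
  have t2 : H (B ∪ Fu) ≤ H (Fs n k ∪ (Pa ∪ Fu)) := by
    apply hH.mono
    rw [← Finset.union_assoc]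
    apply Finset.union_subset_union_left
    intro p; simp only [hB, Fs, hPa, Finset.mem_union, mem_Blk]; omega
  have t3 := hH.subadd Pa Fu
  rw [Finset.union_comm (Ps n L k)]
  have h1 : (0 : ℝ) < θ * (1 / 2) ^ (L - 1) := by positivity
  have h2 : (1 : ℝ) ≤ n (k + 1) := by exact_mod_cast npos (k + 1)
  have h3 : (0 : ℝ) < η k := hηpos k
  have h4 : η k ≤ θ := by
    simp only [hη]
    have : (1 / 2 : ℝ) ^ k ≤ 1 := pow_le_one₀ (by norm_num) (by norm_num)
    nlinarith
  have h5 : ((n (k + 1) - mm n k : ℕ) : ℝ) ≤ n (k + 1) := by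
    exact_mod_cast Nat.sub_le _ _
  have h6 : (h - 3 * η k) * ((n (k + 1) - mm n k : ℕ) : ℝ) ≤ (h - 3 * η k) * n (k + 1) :=
    mul_le_mul_of_nonneg_left h5 (by linarith)
  have h7 : η k ≤ η k * n (k + 1) := le_mul_of_one_le_right h3.le h2
  refine h6.trans ?_
  have h8 : (h - 3 * η k) * n (k + 1) = (h - η k) * n (k + 1) - 2 * (η k * n (k + 1)) := by ring
  rw [h8]
  linarith

end DC2

namespace DC2

/-! ### Hamming balls -/

lemma hamming (A : Type) [Fintype A] [DecidableEq A] (δ : ℝ) (hδ : 0 < δ) :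
    ∃ η : ℝ, 0 < η ∧ ∀ (n : ℕ) (g : Fin n → A),
      ((Finset.univ.filter (fun f : Fin n → A =>
        ((Finset.univ.filter (fun i => f i ≠ g i)).card : ℝ) ≤ η * n)).card : ℝ)
        ≤ Real.exp (δ * n) := by
  obtain ⟨c, hc0, hc⟩ : ∃ c : ℝ, 0 < c ∧ (Fintype.card A : ℝ) * Real.exp (-c) ≤ δ / 2 := by
    have h1 : Tendsto (fun c : ℝ => (Fintype.card A : ℝ) * Real.exp (-c)) atTop
        (nhds ((Fintype.card A : ℝ) * 0)) :=
      (Real.tendsto_exp_neg_atTop_nhds_zero).const_mul _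
    rw [mul_zero] at h1
    have h2 := h1.eventually (ge_mem_nhds (half_pos hδ))
    obtain ⟨c, h3, h4⟩ := (h2.and (eventually_gt_atTop 0)).exists
    exact ⟨c, h4, h3⟩
  refine ⟨δ / (2 * c), by positivity, fun n g => ?_⟩
  set B := Finset.univ.filter (fun f : Fin n → A =>
        ((Finset.univ.filter (fun i => f i ≠ g i)).card : ℝ) ≤ δ / (2 * c) * n) with hB
  have key : ∀ f : Fin n → A, (∏ i, (if f i = g i then 1 else Real.exp (-c))) =
      Real.exp (-c * ((Finset.univ.filter (fun i => f i ≠ g i)).card : ℝ)) := by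
    intro f
    rw [Finset.prod_ite, Finset.prod_const_one, one_mul, Finset.prod_const, ← Real.exp_nat_mul]
    congr 1
    rw [mul_comm]
  have tot : ∑ f : Fin n → A, (∏ i, (if f i = g i then 1 else Real.exp (-c))) ≤
      Real.exp (δ / 2 * n) := by
    have := Finset.prod_univ_sum (fun _ : Fin n => (Finset.univ : Finset A))
      (fun i a => if a = g i then (1 : ℝ) else Real.exp (-c))
    rw [Fintype.piFinset_univ] at this
    rw [← this]
    have h1 : ∀ i : Fin n, ∑ a : A, (if a = g i then (1 : ℝ) else Real.exp (-c)) ≤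
        Real.exp (δ / 2) := by
      intro i
      calc ∑ a : A, (if a = g i then (1 : ℝ) else Real.exp (-c))
          ≤ ∑ a : A, ((if a = g i then (1 : ℝ) else 0) + Real.exp (-c)) := by
            apply Finset.sum_le_sum
            intro a _
            have := Real.exp_pos (-c)
            split_ifs <;> linarith
        _ = 1 + Fintype.card A * Real.exp (-c) := by
            rw [Finset.sum_add_distrib]; simp
        _ ≤ δ / 2 + 1 := by linarith
        _ ≤ _ := Real.add_one_le_exp _
    calc ∏ i : Fin n, ∑ a : A, (if a = g i then (1 : ℝ) else Real.exp (-c))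
        ≤ ∏ i : Fin n, Real.exp (δ / 2) := by
          apply Finset.prod_le_prod
          · intro i _
            apply Finset.sum_nonneg
            intro a _
            have := Real.exp_pos (-c)
            split_ifs <;> linarith
          · intro i _; exact h1 i
      _ = _ := by
          rw [Finset.prod_const, ← Real.exp_nat_mul]; simp [mul_comm]
  have low : (B.card : ℝ) * Real.exp (-(δ / 2 * n)) ≤
      ∑ f : Fin n → A, (∏ i, (if f i = g i then 1 else Real.exp (-c))) := by
    calc (B.card : ℝ) * Real.exp (-(δ / 2 * n)) = ∑ f ∈ B, Real.exp (-(δ / 2 * n)) := by simp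
      _ ≤ ∑ f ∈ B, (∏ i, (if f i = g i then 1 else Real.exp (-c))) := by
          apply Finset.sum_le_sum
          intro f hf
          rw [key f]
          apply Real.exp_le_exp.2
          have := (Finset.mem_filter.1 hf).2
          have h3 : c * ((Finset.univ.filter (fun i => f i ≠ g i)).card : ℝ) ≤
              c * (δ / (2 * c) * n) := mul_le_mul_of_nonneg_left this hc0.le
          have h4 : c * (δ / (2 * c) * n) = δ / 2 * n := by field_simp
          linarith
      _ ≤ _ := by
          apply Finset.sum_le_sum_of_subset_of_nonneg (Finset.subset_univ _)
          intro f _ _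
          rw [key f]; positivity
  have h5 := low.trans tot
  have h6 : (B.card : ℝ) = (B.card : ℝ) * Real.exp (-(δ / 2 * n)) * Real.exp (δ / 2 * n) := by
    rw [mul_assoc, ← Real.exp_add]; simp
  rw [h6]
  calc _ ≤ Real.exp (δ / 2 * n) * Real.exp (δ / 2 * n) := by gcongr
    _ = _ := by rw [← Real.exp_add]; ring_nf

end DC2

namespace DC2

/-! ### Configurations of robustly separated names -/

variable {X : Type*} [MetricSpace X]

/-- `c` orbits with `n`-names in `Fin (K+1)` which are distinct, where distinct symbols force
distance at least `t`. -/
def HasConfig (T : X → X) (t : ℝ) (K n c : ℕ) : Prop :=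
  ∃ (p : Fin c → X) (Y : ℕ → Fin c → Fin (K + 1)),
    (∀ i s s', Y i s ≠ Y i s' → t ≤ dist (T^[i] (p s)) (T^[i] (p s'))) ∧
    (∀ s s', (∀ i < n, Y i s = Y i s') → s = s')

lemma HasConfig.le {T : X → X} {t : ℝ} {K n c : ℕ} (h : HasConfig T t K n c) :
    c ≤ (K + 1) ^ n := by
  obtain ⟨p, Y, _, h2⟩ := h
  have := Fintype.card_le_of_injective (fun (s : Fin c) (i : Fin n) => Y i s) (by
    intro s s' hs
    apply h2
    intro i hi
    exact congrFun hs ⟨i, hi⟩)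
  simpa using this

lemma hasConfig_one [Nonempty X] (T : X → X) (t : ℝ) (K n : ℕ) : HasConfig T t K n 1 :=
  ⟨fun _ => Classical.arbitrary X, fun _ _ => 0, by simp, fun s s' _ => Subsingleton.elim _ _⟩

/-- The maximal number of orbits in a configuration. -/
noncomputable def Nmax (T : X → X) (t : ℝ) (K n : ℕ) : ℕ := sSup {c | HasConfig T t K n c}

lemma Nmax_bdd (T : X → X) (t : ℝ) (K n : ℕ) : BddAbove {c | HasConfig T t K n c} :=
  ⟨(K + 1) ^ n, fun _ h => HasConfig.le h⟩

lemma le_Nmax {T : X → X} {t : ℝ} {K n c : ℕ} (h : HasConfig T t K n c) : c ≤ Nmax T t K n :=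
  le_csSup (Nmax_bdd T t K n) h

lemma Nmax_spec [Nonempty X] (T : X → X) (t : ℝ) (K n : ℕ) : HasConfig T t K n (Nmax T t K n) :=
  Nat.sSup_mem (s := {c | HasConfig T t K n c}) ⟨1, hasConfig_one T t K n⟩ (Nmax_bdd T t K n)

open Classical in
lemma window {ι : Type*} [Fintype ι] (T : X → X) (t : ℝ) (K : ℕ) (p : ι → X)
    (Y : ℕ → ι → Fin (K + 1))
    (hY : ∀ i s s', Y i s ≠ Y i s' → t ≤ dist (T^[i] (p s)) (T^[i] (p s'))) (a n : ℕ) :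
    (Finset.univ.image (fun (s : ι) (i : Fin n) => Y (a + i) s)).card ≤ Nmax T t K n := by
  set B := Finset.univ.image (fun (s : ι) (i : Fin n) => Y (a + i) s) with hB
  apply le_Nmax
  let e := B.equivFin.symm
  have hr : ∀ j : Fin B.card, ∃ s : ι, (fun i : Fin n => Y (a + i) s) = (e j : Fin n → Fin (K + 1)) := by
    intro j
    have := (e j).2
    obtain ⟨s, _, hs⟩ := Finset.mem_image.1 this
    exact ⟨s, hs⟩
  choose r hr using hr
  refine ⟨fun j => T^[a] (p (r j)), fun i j => Y (a + i) (r j), ?_, ?_⟩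
  · intro i s s' h
    have := hY _ _ _ h
    rw [← Function.iterate_add_apply, ← Function.iterate_add_apply, add_comm i a]
    exact this
  · intro s s' h
    apply e.injective
    apply Subtype.ext
    rw [← hr, ← hr]
    funext i
    exact h i i.2

lemma Nmax_add [Nonempty X] (T : X → X) (t : ℝ) (K m n : ℕ) :
    Nmax T t K (m + n) ≤ Nmax T t K m * Nmax T t K n := by
  classical
  obtain ⟨p, Y, h1, h2⟩ := Nmax_spec T t K (m + n)
  have w1 := window T t K p Y h1 0 m
  have w2 := window T t K p Y h1 m n
  calc Nmax T t K (m + n) = (Finset.univ : Finset (Fin (Nmax T t K (m + n)))).card := by simp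
    _ ≤ ((Finset.univ.image (fun s (i : Fin m) => Y (0 + i) s)) ×ˢ
        (Finset.univ.image (fun s (i : Fin n) => Y (m + i) s))).card := by
      apply Finset.card_le_card_of_injOn
        (fun s => ((fun (i : Fin m) => Y (0 + i) s), (fun (i : Fin n) => Y (m + i) s)))
      · intro s _
        simp
      · intro s _ s' _ h
        simp only [Prod.mk.injEq] at h
        apply h2
        intro i hi
        by_cases him : i < m
        · have := congrFun h.1 ⟨i, him⟩
          simpa using this
        · have := congrFun h.2 ⟨i - m, by omega⟩
          simp only at this
          rwa [show m + (i - m) = i by omega] at this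
    _ ≤ _ := by
      rw [Finset.card_product]
      exact Nat.mul_le_mul w1 w2

lemma Nmax_pos [Nonempty X] (T : X → X) (t : ℝ) (K n : ℕ) : 0 < Nmax T t K n :=
  le_Nmax (hasConfig_one T t K n)

lemma Nmax_subadd [Nonempty X] (T : X → X) (t : ℝ) (K : ℕ) :
    Subadditive (fun n => Real.log (Nmax T t K n)) := by
  intro m n
  have a := Nmax_pos T t K m
  have b := Nmax_pos T t K n
  have c := Nmax_pos T t K (m + n)
  simp only
  rw [← Real.log_mul (by positivity) (by positivity)]
  apply Real.log_le_log (by positivity)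
  exact_mod_cast Nmax_add T t K m n

lemma growth [Nonempty X] (T : X → X) (t : ℝ) (K : ℕ) (g : ℝ)
    (hg : ∃ᶠ n : ℕ in atTop, Real.exp (g * n) ≤ Nmax T t K n) :
    ∃ h : ℝ, g ≤ h ∧ (∀ n : ℕ, Real.exp (h * n) ≤ Nmax T t K n) ∧
      ∀ δ : ℝ, 0 < δ → ∀ᶠ n : ℕ in atTop, (Nmax T t K n : ℝ) ≤ Real.exp ((h + δ) * n) := by
  have hs := Nmax_subadd T t K
  have hN : ∀ n, (0 : ℝ) < Nmax T t K n := fun n => by exact_mod_cast Nmax_pos T t K n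
  have hb : BddBelow (Set.range fun n : ℕ => Real.log (Nmax T t K n) / n) := by
    refine ⟨0, ?_⟩
    rintro _ ⟨n, rfl⟩
    have : 0 ≤ Real.log (Nmax T t K n) := Real.log_natCast_nonneg _
    simp only
    positivity
  have hl := hs.tendsto_lim hb
  refine ⟨hs.lim, ?_, ?_, ?_⟩
  · apply ge_of_tendsto_of_frequently hl
    refine (hg.and_eventually (eventually_gt_atTop 0)).mono ?_
    rintro n ⟨h1, h2⟩
    rw [← Real.le_log_iff_exp_le (hN n)] at h1
    rw [le_div_iff₀ (by exact_mod_cast h2)]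
    exact h1
  · intro n
    rcases Nat.eq_zero_or_pos n with rfl | hn
    · have : 1 ≤ Nmax T t K 0 := Nmax_pos T t K 0
      simpa using this
    · rw [← Real.le_log_iff_exp_le (hN n)]
      have := hs.lim_le_div hb hn.ne'
      rwa [le_div_iff₀ (by exact_mod_cast hn)] at this
  · intro δ hδ
    have := hl.eventually (gt_mem_nhds (show hs.lim < hs.lim + δ by linarith))
    filter_upwards [this, eventually_gt_atTop 0] with n h1 h2
    rw [← Real.log_le_iff_le_exp (hN n)]
    rw [div_lt_iff₀ (by exact_mod_cast h2)] at h1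
    exact h1.le

end DC2

namespace DC2

/-! ### Positive entropy produces robust configurations -/

variable {X : Type*} [MetricSpace X]

lemma exists_sep (T : X → X) (hent : 0 < Dynamics.coverEntropy T (Set.univ : Set X)) :
    ∃ ε : ℝ, 0 < ε ∧ ∃ g : ℝ, 0 < g ∧ ∃ᶠ N : ℕ in atTop, ∃ s : Finset X,
      Real.exp (g * N) ≤ s.card ∧
      ∀ x ∈ s, ∀ y ∈ s, x ≠ y → ∃ i < N, ε ≤ dist (T^[i] x) (T^[i] y) := by
  rw [Dynamics.coverEntropy_eq_iSup_basis_netEntropyEntourage Metric.uniformity_basis_dist,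
    lt_iSup_iff] at hent
  obtain ⟨ε, hent⟩ := hent
  rw [lt_iSup_iff] at hent
  obtain ⟨hε, hent⟩ := hent
  obtain ⟨g, hg0, hg⟩ := EReal.lt_iff_exists_real_btwn.1 hent
  have hg0' : (0 : ℝ) < g := by exact_mod_cast hg0
  refine ⟨ε, hε, g, hg0', ?_⟩
  have := ExpGrowth.frequently_exp_le hg
  refine this.mono ?_
  intro N hN
  by_contra hcon
  push Not at hcon
  have hbd : Dynamics.netMaxcard T Set.univ {p : X × X | dist p.1 p.2 < ε} N ≤
      ((⌈Real.exp (g * N)⌉₊ - 1 : ℕ) : ℕ∞) := by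
    unfold Dynamics.netMaxcard
    refine iSup₂_le ?_
    intro s hs
    by_cases hsc : Real.exp (g * N) ≤ s.card
    · exfalso
      obtain ⟨x, hx, y, hy, hxy, hd⟩ := hcon s hsc
      have := hs.2 hx hy hxy
      refine (Set.disjoint_left.1 this : _) (?_ : y ∈ _) ?_
      · rw [Dynamics.mem_ball_dynEntourage]
        intro k hk
        exact hd k hk
      · rw [Dynamics.mem_ball_dynEntourage]
        intro k hk
        simpa [UniformSpace.ball] using hε
    · have h1 := Nat.lt_ceil.2 (not_le.1 hsc)
      have h2 : s.card ≤ ⌈Real.exp (g * N)⌉₊ - 1 := by omega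
      exact_mod_cast h2
  have hlt : ((⌈Real.exp (g * N)⌉₊ - 1 : ℕ) : ℝ) < Real.exp (g * N) := by
    rw [← Nat.lt_ceil]
    have : 0 < ⌈Real.exp (g * N)⌉₊ := Nat.ceil_pos.2 (Real.exp_pos _)
    omega
  have e1 : EReal.exp ((g : EReal) * (N : EReal)) = ENNReal.ofReal (Real.exp (g * N)) := by
    rw [← EReal.exp_coe]; simp
  have e2 : ((Dynamics.netMaxcard T Set.univ {p : X × X | dist p.1 p.2 < ε} N : ℕ∞) : ENNReal) ≤
      ((⌈Real.exp (g * N)⌉₊ - 1 : ℕ) : ENNReal) := by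
    have := ENat.toENNReal_mono hbd
    simpa using this
  rw [e1] at hN
  have h3 := hN.trans e2
  rw [← ENNReal.ofReal_natCast] at h3
  have := (ENNReal.ofReal_le_ofReal_iff (by positivity)).1 h3
  linarith

lemma card_le_Nmax (T : X → X) (t : ℝ) (K n : ℕ) (s : Finset X) (Y : ℕ → X → Fin (K + 1))
    (hY : ∀ i, ∀ x ∈ s, ∀ y ∈ s, Y i x ≠ Y i y → t ≤ dist (T^[i] x) (T^[i] y))
    (hinj : ∀ x ∈ s, ∀ y ∈ s, (∀ i < n, Y i x = Y i y) → x = y) : s.card ≤ Nmax T t K n := by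
  apply le_Nmax
  let e := s.equivFin.symm
  refine ⟨fun j => (e j : X), fun i j => Y i (e j), ?_, ?_⟩
  · intro i a b hab
    exact hY i _ (e a).2 _ (e b).2 hab
  · intro a b hab
    apply e.injective
    apply Subtype.ext
    exact hinj _ (e a).2 _ (e b).2 hab

lemma exists_cover [CompactSpace X] [Nonempty X] (r : ℝ) (hr : 0 < r) :
    ∃ (K : ℕ) (pc : Fin (K + 1) → X), ∀ x, ∃ i, dist x (pc i) < r := by
  obtain ⟨t, _, ht, hc⟩ := (isCompact_univ : IsCompact (Set.univ : Set X)).finite_cover_balls hr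
  have hne : ht.toFinset.Nonempty := by
    obtain ⟨x⟩ := ‹Nonempty X›
    have := hc (Set.mem_univ x)
    simp only [Set.mem_iUnion] at this
    obtain ⟨y, hy, _⟩ := this
    exact ⟨y, by simpa using hy⟩
  obtain ⟨K, hK⟩ : ∃ K, ht.toFinset.card = K + 1 :=
    ⟨ht.toFinset.card - 1, by have := Finset.card_pos.2 hne; omega⟩
  let e := (ht.toFinset.equivFinOfCardEq hK)
  refine ⟨K, fun i => (e.symm i : X), fun x => ?_⟩
  have := hc (Set.mem_univ x)
  simp only [Set.mem_iUnion] at this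
  obtain ⟨y, hy, hxy⟩ := this
  refine ⟨e ⟨y, by simpa using hy⟩, ?_⟩
  simpa using hxy

lemma exists_thin (M N : ℕ) (hM : 0 < M) (R : ℕ → ℕ → Prop)
    (hR : ∀ n u u', R u n → R u' n → u = u') :
    ∃ u : Fin M, by classical exact M * ((Finset.range N).filter (R u)).card ≤ N := by
  classical
  by_contra hcon
  push Not at hcon
  have h1 : ∑ u : Fin M, N < ∑ u : Fin M, M * ((Finset.range N).filter (R u)).card := by
    apply Finset.sum_lt_sum_of_nonempty
    · exact ⟨⟨0, hM⟩, Finset.mem_univ _⟩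
    · intro u _
      have := hcon u
      convert this
  rw [← Finset.mul_sum] at h1
  simp only [Finset.sum_const, Finset.card_univ, Fintype.card_fin, smul_eq_mul] at h1
  have h2 := Nat.lt_of_mul_lt_mul_left h1
  rw [← Finset.card_biUnion] at h2
  · have h3 := Finset.card_le_card (s := Finset.univ.biUnion fun u : Fin M =>
      (Finset.range N).filter (R u)) (t := Finset.range N) (by
        intro n hn
        simp only [Finset.mem_biUnion, Finset.mem_filter] at hn
        obtain ⟨_, _, h, _⟩ := hn
        exact h)
    rw [Finset.card_range] at h3
    omega
  · intro u _ u' _ huu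
    refine Finset.disjoint_left.2 ?_
    intro n h1 h2
    exact huu (Fin.ext (hR n _ _ (Finset.mem_filter.1 h1).2 (Finset.mem_filter.1 h2).2))

lemma config_of_sep [CompactSpace X] [Nonempty X] (T : X → X) (ε : ℝ) (hε : 0 < ε) (δ : ℝ)
    (hδ : 0 < δ) : ∃ (t : ℝ) (K C : ℕ), 0 < t ∧ ∀ (N : ℕ) (s : Finset X),
      (∀ x ∈ s, ∀ y ∈ s, x ≠ y → ∃ i < N, ε ≤ dist (T^[i] x) (T^[i] y)) →
      (s.card : ℝ) ≤ Nmax T t K N * (C * Real.exp (δ * N)) := by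
  classical
  obtain ⟨r, hr, hrε⟩ : ∃ r : ℝ, 0 < r ∧ ε = 8 * r := ⟨ε / 8, by positivity, by ring⟩
  obtain ⟨K, pc, hpc⟩ := exists_cover (X := X) r hr
  choose c0 hc0 using hpc
  obtain ⟨η, hη, hham⟩ := hamming (Option (Fin (K + 1))) δ hδ
  obtain ⟨M', hM'⟩ := exists_nat_ge ((K + 1) / η)
  obtain ⟨M, hM, hMη⟩ : ∃ M : ℕ, 0 < M ∧ ((K : ℝ) + 1) ≤ η * M := by
    refine ⟨M' + 1, by omega, ?_⟩
    rw [div_le_iff₀ hη] at hM'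
    push_cast
    nlinarith
  have hMr : (0 : ℝ) < M := by exact_mod_cast hM
  let ρ : ℕ → ℝ := fun u => r * (1 + u / M)
  have ρstep : ∀ u, ρ (u + 1) = ρ u + r / M := by
    intro u; simp only [ρ]; push_cast; ring
  have ρmono : ∀ u v, u ≤ v → ρ u ≤ ρ v := by
    intro u v h
    have : (u : ℝ) ≤ v := by exact_mod_cast h
    simp only [ρ]
    gcongr
  have ρ0 : ∀ u, r ≤ ρ u := by
    intro u
    have := ρmono 0 u (Nat.zero_le _)
    simpa [ρ] using this
  have ρle : ∀ u, u < M → ρ u ≤ 2 * r := by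
    intro u h
    have h1 : (u : ℝ) / M ≤ 1 := by
      rw [div_le_one hMr]; exact_mod_cast h.le
    simp only [ρ]
    nlinarith
  let ann : Fin (K + 1) → ℕ → X → Prop := fun i u x =>
    ρ u ≤ dist x (pc i) ∧ dist x (pc i) < ρ (u + 1)
  have ann_disj : ∀ i u u' x, ann i u x → ann i u' x → u = u' := by
    intro i u u' x h h'
    by_contra hne
    rcases lt_or_gt_of_ne hne with hlt | hlt
    · have := ρmono _ _ (Nat.succ_le_of_lt hlt)
      linarith [h.2, h'.1]
    · have := ρmono _ _ (Nat.succ_le_of_lt hlt)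
      linarith [h'.2, h.1]
  refine ⟨r / M, K, M ^ (K + 1), by positivity, ?_⟩
  intro N s hs
  have hu : ∀ (x : X) (i : Fin (K + 1)), ∃ u : Fin M,
      M * ((Finset.range N).filter (fun n => ann i u (T^[n] x))).card ≤ N := by
    intro x i
    obtain ⟨u, h⟩ := exists_thin M N hM (fun u n => ann i u (T^[n] x))
      (fun n u u' => ann_disj i u u' _)
    refine ⟨u, ?_⟩
    convert h
  choose u hu using hu
  let Z : X → ℕ → Prop := fun x n => ∃ i, ann i (u x i) (T^[n] x)
  let f : X → Fin N → Option (Fin (K + 1)) := fun x n =>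
    if Z x n then some (c0 (T^[n] x)) else none
  set Bl := (Finset.univ.filter (fun f : Fin N → Option (Fin (K + 1)) =>
        ((Finset.univ.filter (fun i => f i ≠ none)).card : ℝ) ≤ η * N)) with hBl
  have hBlc : (Bl.card : ℝ) ≤ Real.exp (δ * N) := hham N (fun _ => none)
  have hfB : ∀ x, f x ∈ Bl := by
    intro x
    rw [hBl, Finset.mem_filter]
    refine ⟨Finset.mem_univ _, ?_⟩
    have h1 : (Finset.univ.filter (fun i => f x i ≠ none)).card ≤
        (Finset.univ.biUnion (fun i => (Finset.range N).filter
          (fun n => ann i (u x i) (T^[n] x)))).card := by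
      apply Finset.card_le_card_of_injOn (fun i : Fin N => (i : ℕ))
      · intro n hn
        have hn : f x n ≠ none := (Finset.mem_filter.1 hn).2
        have hz : Z x n := by
          by_contra hz
          exact hn (by simp only [f, if_neg hz])
        obtain ⟨i, hi⟩ := hz
        simp only [Finset.coe_biUnion, Set.mem_iUnion, Finset.mem_coe, Finset.mem_filter]
        exact ⟨i, Finset.mem_univ _, Finset.mem_range.2 n.2, hi⟩
      · intro a _ b _ h
        exact Fin.ext h
    have h2 := h1.trans Finset.card_biUnion_le
    have h3 : M * (Finset.univ.filter (fun i => f x i ≠ none)).card ≤ (K + 1) * N := by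
      calc _ ≤ M * _ := Nat.mul_le_mul_left _ h2
        _ ≤ ∑ i : Fin (K + 1), N := by
          rw [Finset.mul_sum]
          exact Finset.sum_le_sum fun i _ => hu x i
        _ = _ := by simp
    have h4 : (M : ℝ) * ((Finset.univ.filter (fun i => f x i ≠ none)).card : ℝ) ≤ (K + 1) * N := by
      exact_mod_cast h3
    have h5 : ((K : ℝ) + 1) * N ≤ η * M * N := by gcongr
    have h6 : (M : ℝ) * ((Finset.univ.filter (fun i => f x i ≠ none)).card : ℝ) ≤
        M * (η * N) := by linarith
    exact le_of_mul_le_mul_left h6 hMr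
  have pig := Finset.card_le_mul_card_image_of_maps_to (s := s) (f := fun x => (u x, f x))
    (t := Finset.univ ×ˢ Bl) (fun x _ => by simp [hfB x]) (Nmax T (r / M) K N) (by
      rintro ⟨v, w⟩ _
      have hmem : ∀ x ∈ s.filter (fun x => (u x, f x) = (v, w)), x ∈ s ∧ u x = v ∧ f x = w := by
        intro x hx
        have := Finset.mem_filter.1 hx
        exact ⟨this.1, (Prod.mk.inj this.2).1, (Prod.mk.inj this.2).2⟩
      let S : X → Set (Fin (K + 1)) := fun x => {i | dist x (pc i) < ρ (v i)}
      let Y : ℕ → X → Fin (K + 1) := fun n x =>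
        if h : n < N then (if w ⟨n, h⟩ = none then Classical.epsilon (fun i => i ∈ S (T^[n] x))
          else 0) else 0
      have hZ : ∀ x, u x = v → f x = w → ∀ n (h : n < N), w ⟨n, h⟩ = none →
          ∀ i, ¬ ann i (v i) (T^[n] x) := by
        intro x hx1 hx2 n hn hwn i hi
        have : Z x n := ⟨i, by rw [hx1]; exact hi⟩
        rw [← hx2] at hwn
        simp only [f, if_pos this] at hwn
        cases hwn
      have hstep : ∀ a b : X, (∀ i, ¬ ann i (v i) b) → dist a b < r / M → S a ⊆ S b := by
        intro a b hb hab i hi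
        by_contra hcon
        have h1 : dist a (pc i) < ρ (v i) := hi
        have h2 : ρ (v i) ≤ dist b (pc i) := not_lt.1 hcon
        have h3 : ρ (v i + 1) ≤ dist b (pc i) := by
          by_contra h4
          exact hb i ⟨h2, not_le.1 h4⟩
        rw [ρstep] at h3
        have h4 := dist_triangle b a (pc i)
        rw [dist_comm b a] at h4
        linarith
      apply card_le_Nmax T (r / M) K N _ Y
      · intro n x hx y hy hne
        obtain ⟨hx, hx1, hx2⟩ := hmem x hx
        obtain ⟨hy, hy1, hy2⟩ := hmem y hy
        by_contra hcon
        push Not at hcon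
        apply hne
        simp only [Y]
        split_ifs with h1 h2
        · have : S (T^[n] x) = S (T^[n] y) := by
            apply Set.Subset.antisymm
            · exact hstep _ _ (hZ y hy1 hy2 n h1 h2) hcon
            · exact hstep _ _ (hZ x hx1 hx2 n h1 h2) (by rwa [dist_comm])
          rw [this]
        · rfl
        · rfl
      · intro x hx y hy hxy
        obtain ⟨hx, hx1, hx2⟩ := hmem x hx
        obtain ⟨hy, hy1, hy2⟩ := hmem y hy
        by_contra hne
        obtain ⟨n, hn, hd⟩ := hs x hx y hy hne
        have hY := hxy n hn
        by_cases hw : w ⟨n, hn⟩ = none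
        · simp only [Y, dif_pos hn, if_pos hw] at hY
          have key : ∀ z : X, dist z (pc (Classical.epsilon (fun i => i ∈ S z))) < 2 * r := by
            intro z
            have : ∃ i, i ∈ S z := ⟨c0 z, lt_of_lt_of_le (hc0 z) (ρ0 _)⟩
            have h1 : dist z (pc (Classical.epsilon (fun i => i ∈ S z))) <
              ρ (v (Classical.epsilon (fun i => i ∈ S z))) := Classical.epsilon_spec this
            exact h1.trans_le (ρle _ (v _).2)
          have k1 := key (T^[n] x)
          have k2 := key (T^[n] y)
          rw [hY] at k1
          have := dist_triangle_right (T^[n] x) (T^[n] y)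
            (pc (Classical.epsilon (fun i => i ∈ S (T^[n] y))))
          linarith
        · have key : ∀ z, f z = w → w ⟨n, hn⟩ = some (c0 (T^[n] z)) := by
            intro z hz
            rw [← hz] at hw ⊢
            simp only [f] at hw ⊢
            by_cases hZz : Z z n
            · rw [if_pos hZz]
            · rw [if_neg hZz] at hw; exact absurd rfl hw
          have e1 := (key x hx2).symm.trans (key y hy2)
          have e2 : c0 (T^[n] x) = c0 (T^[n] y) := Option.some.inj e1
          have k1 := hc0 (T^[n] x)
          have k2 := hc0 (T^[n] y)
          rw [e2] at k1
          have := dist_triangle_right (T^[n] x) (T^[n] y) (pc (c0 (T^[n] y)))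
          linarith)
  rw [Finset.card_product] at pig
  have pig' : (s.card : ℝ) ≤ Nmax T (r / M) K N * ((M ^ (K + 1) : ℕ) * Bl.card) := by
    have e : (Finset.univ : Finset (Fin (K + 1) → Fin M)).card = M ^ (K + 1) := by simp
    rw [e] at pig
    exact_mod_cast pig
  refine pig'.trans ?_
  gcongr

/-- Conclusion of the first part: maximal configurations grow exponentially. -/
lemma exists_growth [CompactSpace X] [Nonempty X] (T : X → X)
    (hent : 0 < Dynamics.coverEntropy T (Set.univ : Set X)) :
    ∃ (t : ℝ) (K : ℕ) (h : ℝ), 0 < t ∧ 0 < h ∧ (∀ n : ℕ, Real.exp (h * n) ≤ Nmax T t K n) ∧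
      ∀ δ : ℝ, 0 < δ → ∀ᶠ n : ℕ in atTop, (Nmax T t K n : ℝ) ≤ Real.exp ((h + δ) * n) := by
  obtain ⟨ε, hε, g, hg, hfr⟩ := exists_sep T hent
  obtain ⟨t, K, C, ht, hC⟩ := config_of_sep T ε hε (g / 2) (by positivity)
  obtain ⟨h, h1, h2, h3⟩ := growth T t K (g / 4) (by
    have ev : ∀ᶠ N : ℕ in atTop, (C : ℝ) ≤ Real.exp (g / 4 * N) := by
      have : Tendsto (fun N : ℕ => Real.exp (g / 4 * N)) atTop atTop :=
        Real.tendsto_exp_atTop.comp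
          (tendsto_natCast_atTop_atTop.const_mul_atTop (by positivity))
      exact this.eventually_ge_atTop _
    refine (hfr.and_eventually ev).mono ?_
    rintro N ⟨⟨s, hs1, hs2⟩, hN⟩
    have a1 := hs1.trans (hC N s hs2)
    have a2 : (Nmax T t K N : ℝ) * (C * Real.exp (g / 2 * N)) ≤
        Nmax T t K N * (Real.exp (g / 4 * N) * Real.exp (g / 2 * N)) := by gcongr
    have a3 : Real.exp (g * N) = Real.exp (g / 4 * N) *
        (Real.exp (g / 4 * N) * Real.exp (g / 2 * N)) := by
      rw [← Real.exp_add, ← Real.exp_add]; ring_nf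
    have a4 := a1.trans a2
    rw [a3] at a4
    exact le_of_mul_le_mul_right a4 (by positivity))
  exact ⟨t, K, h, ht, by linarith, h2, h3⟩

end DC2

namespace DC2

/-! ### Limit of averaged entropies -/

/-- Time average of an entropy functional. -/
noncomputable def avg (e : ℕ → Finset (ℕ × ℕ) → ℝ) (N : ℕ) (F : Finset (ℕ × ℕ)) : ℝ :=
  (∑ a ∈ Finset.range N, e N (sh a F)) / N

lemma sh_empty (a : ℕ) : sh a ∅ = ∅ := by simp [sh]

lemma sum_sh (l : ℕ → ℝ) (a : ℕ) (F : Finset (ℕ × ℕ)) :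
    ∑ p ∈ sh a F, l p.1 = ∑ p ∈ F, l p.1 := by
  unfold sh
  rw [Finset.sum_image]
  intro p _ q _ h
  simp only [Prod.mk.injEq, add_left_inj] at h
  exact Prod.ext h.1 h.2

lemma exists_limit (e : ℕ → Finset (ℕ × ℕ) → ℝ) (he0 : ∀ N, e N ∅ = 0)
    (hmono : ∀ N F G, F ⊆ G → e N F ≤ e N G)
    (hsub : ∀ N A B C, C ⊆ A → C ⊆ B → e N (A ∪ B) + e N C ≤ e N A + e N B)
    (l : ℕ → ℝ) (hl : ∀ N F, e N F ≤ ∑ p ∈ F, l p.1) (h : ℝ)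
    (hbig : ∀ N n, h * N ≤ e N (Blk 1 0 (N + n)) - e N (Blk 1 N (N + n))) :
    ∃ H : Finset (ℕ × ℕ) → ℝ, Poly H ∧ (∀ n : ℕ, h * n ≤ H (Blk 1 0 n)) ∧
      ∀ F, Tendsto (fun N => avg e N F) (hyperfilter ℕ) (nhds (H F)) := by
  have hnn : ∀ N F, 0 ≤ e N F := fun N F => by
    have := hmono N ∅ F (Finset.empty_subset _)
    rwa [he0] at this
  have hb0 : ∀ N F, 0 ≤ avg e N F := fun N F => by
    unfold avg
    have : 0 ≤ ∑ a ∈ Finset.range N, e N (sh a F) := Finset.sum_nonneg fun a _ => hnn _ _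
    positivity
  have hbd0 : ∀ F : Finset (ℕ × ℕ), 0 ≤ ∑ p ∈ F, l p.1 := fun F => (hnn 0 F).trans (hl 0 F)
  have hb1 : ∀ N F, avg e N F ≤ ∑ p ∈ F, l p.1 := fun N F => by
    unfold avg
    rcases Nat.eq_zero_or_pos N with rfl | hN
    · simpa using hbd0 F
    · rw [div_le_iff₀ (by exact_mod_cast hN)]
      calc ∑ a ∈ Finset.range N, e N (sh a F) ≤ ∑ a ∈ Finset.range N, ∑ p ∈ F, l p.1 := by
            apply Finset.sum_le_sum
            intro a _
            rw [← sum_sh l a F]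
            exact hl _ _
        _ = _ := by simp [mul_comm]
  have hex : ∀ F, ∃ y : ℝ, Tendsto (fun N => avg e N F) (hyperfilter ℕ) (nhds y) := by
    intro F
    have hc : IsCompact (Set.Icc 0 (∑ p ∈ F, l p.1)) := isCompact_Icc
    obtain ⟨y, _, hy⟩ := hc.ultrafilter_le_nhds ((hyperfilter ℕ).map (fun N => avg e N F)) (by
      rw [le_principal_iff]
      exact Filter.mem_map.2 (Filter.univ_mem' fun N : ℕ => ⟨hb0 N F, hb1 N F⟩))
    exact ⟨y, hy⟩
  choose H hH using hex
  have hle : (hyperfilter ℕ : Filter ℕ) ≤ atTop := Nat.hyperfilter_le_atTop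
  have hshift1 : ∀ F, H (sh 1 F) = H F := by
    intro F
    have t1 := (hH (sh 1 F)).sub (hH F)
    have t2 : Tendsto (fun N : ℕ => avg e N (sh 1 F) - avg e N F) atTop (nhds 0) := by
      apply squeeze_zero_norm (a := fun N : ℕ => (∑ p ∈ F, l p.1) / N)
      · intro N
        have : avg e N (sh 1 F) - avg e N F = (e N (sh N F) - e N (sh 0 F)) / N := by
          unfold avg
          rw [← sub_div, ← Finset.sum_sub_distrib, ← Finset.sum_range_sub (fun a => e N (sh a F))]
          congr 1
          apply Finset.sum_congr rfl
          intro a _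
          rw [sh_sh, add_comm 1 a]
        rw [this, norm_div, Real.norm_natCast]
        apply div_le_div_of_nonneg_right _ (Nat.cast_nonneg N)
        have u1 := hl N (sh N F)
        have u2 := hl N (sh 0 F)
        rw [sum_sh] at u1 u2
        rw [Real.norm_eq_abs, abs_le]
        constructor <;> linarith [hnn N (sh N F), hnn N (sh 0 F)]
      · exact tendsto_const_div_atTop_nhds_zero_nat _
    have := tendsto_nhds_unique t1 (t2.mono_left hle)
    linarith
  have hshift : ∀ a F, H (sh a F) = H F := by
    intro a
    induction a with
    | zero => intro F; rw [sh_zero]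
    | succ a ih =>
      intro F
      rw [← sh_sh 1 a, hshift1, ih]
  refine ⟨H, ⟨?_, ?_, ?_, hshift⟩, ?_, hH⟩
  · have : ∀ N, avg e N ∅ = 0 := fun N => by simp [avg, sh_empty, he0]
    have t := hH ∅
    simp only [this] at t
    exact tendsto_nhds_unique t tendsto_const_nhds
  · intro A B hAB
    refine le_of_tendsto_of_tendsto' (hH A) (hH B) ?_
    intro N
    unfold avg
    gcongr
    exact hmono _ _ _ (sh_mono _ hAB)
  · intro A B C hA hB
    refine le_of_tendsto_of_tendsto' ((hH (A ∪ B)).add (hH C)) ((hH A).add (hH B)) ?_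
    intro N
    unfold avg
    rw [← add_div, ← add_div, ← Finset.sum_add_distrib, ← Finset.sum_add_distrib]
    apply div_le_div_of_nonneg_right _ (Nat.cast_nonneg N)
    apply Finset.sum_le_sum
    intro a _
    rw [sh_union]
    exact hsub _ _ _ _ (sh_mono _ hA) (sh_mono _ hB)
  · have hstep : ∀ n, h ≤ H (Blk 1 0 (n + 1)) - H (Blk 1 0 n) := by
      intro n
      have e1 : H (Blk 1 0 n) = H (Blk 1 1 (n + 1)) := by
        rw [← hshift 1 (Blk 1 0 n), sh_Blk, zero_add]
      rw [e1]
      refine ge_of_tendsto ((hH (Blk 1 0 (n + 1))).sub (hH (Blk 1 1 (n + 1)))) ?_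
      apply hle
      filter_upwards [eventually_gt_atTop 0] with N hN
      unfold avg
      rw [← sub_div, le_div_iff₀ (by exact_mod_cast hN), ← Finset.sum_sub_distrib]
      refine (hbig N n).trans ?_
      have tel := Finset.sum_range_sub' (fun a => e N (Blk 1 a (N + n))) N
      rw [← tel]
      apply Finset.sum_le_sum
      intro a ha
      have ha := Finset.mem_range.1 ha
      rw [sh_Blk, sh_Blk]
      have := hsub N (Blk 1 a (a + n + 1)) (Blk 1 (a + 1) (N + n)) (Blk 1 (a + 1) (a + n + 1))
        (by intro p; simp only [mem_Blk]; omega) (by intro p; simp only [mem_Blk]; omega)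
      rw [show Blk 1 a (a + n + 1) ∪ Blk 1 (a + 1) (N + n) = Blk 1 a (N + n) by
        ext p; simp only [mem_Blk, Finset.mem_union]; omega] at this
      rw [show 0 + a = a by omega, show n + 1 + a = a + n + 1 by omega, show 1 + a = a + 1 by omega]
      linarith
    intro n
    induction n with
    | zero =>
      have : ∀ N, avg e N ∅ = 0 := fun N => by simp [avg, sh_empty, he0]
      have t := hH ∅
      simp only [this] at t
      have := tendsto_nhds_unique t tendsto_const_nhds
      simp [Blk, this]
    | succ n ih =>
      have := hstep n
      push_cast
      linarith

lemma ent_le_sum {ι : Type*} [Fintype ι] [Nonempty ι] (V : ℕ × ℕ → ι → ℕ) (A : ℕ → ℕ)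
    (hA : ∀ p s, V p s < A p.1) (F : Finset (ℕ × ℕ)) :
    ent V F ≤ ∑ p ∈ F, (Real.log 2 + Real.log (A p.1)) := by
  classical
  induction F using Finset.induction_on with
  | empty => simp [ent_empty]
  | insert p F hp ih =>
    rw [Finset.sum_insert hp]
    have h1 := ent_submod V {p} F ∅ (Finset.empty_subset _) (Finset.empty_subset _)
    rw [ent_empty] at h1
    have hApos : 0 < A p.1 := lt_of_le_of_lt (Nat.zero_le _) (hA p (Classical.arbitrary ι))
    have h2 := ent_cond_le V ∅ {p} (fun s => V p s) (by
      intro s s' h j hj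
      rw [Finset.mem_singleton.1 hj]; exact h) ∅ 1 (A p.1) one_pos (by exact_mod_cast hApos)
      (by intro s; simp) (by
        intro s
        have : ((Finset.univ.filter (Agree V ∅ s ·)).image (fun s => V p s)).card ≤
          (Finset.range (A p.1)).card := by
          apply Finset.card_le_card
          intro v hv
          obtain ⟨s', _, rfl⟩ := Finset.mem_image.1 hv
          exact Finset.mem_range.2 (hA p s')
        rw [Finset.card_range] at this
        have h3 : (((Finset.univ.filter (Agree V ∅ s ·)).image (fun s => V p s)).card : ℝ) ≤
          (A p.1 : ℝ) := by exact_mod_cast this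
        convert h3)
    rw [ent_empty] at h2
    simp only [Finset.empty_union, Finset.card_empty, Nat.cast_zero, zero_div, zero_mul,
      sub_zero, one_mul, add_zero] at h2
    rw [Finset.insert_eq]
    linarith

end DC2

namespace DC2

/-! ### The winning positions and the binary tree -/

lemma exists_win {ι J : Type*} [Fintype ι] [Nonempty ι] [DecidableEq J] (V : J → ι → ℕ)
    (L : ℕ) (P F : ℕ → Finset J) (β : ℕ → Type) (y : ∀ k, ι → β k)
    (hy : ∀ k s s', y k s' = y k s → Agree V (F k) s s')
    (b m τ : ℕ → ℝ) (hb : ∀ k, 0 < b k) (hbm : ∀ k < L, Real.log (b k) < Real.log (m k))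
    (hm : ∀ k, 0 < m k)
    (hM : ∀ k < L, ∀ D : Finset ι, by classical exact ((D.image (y k)).card : ℝ) ≤ m k)
    (hτ : ∀ k < L, Real.log 2 + Real.log (m k) - (ent V (P k ∪ F k) - ent V (P k)) ≤
      τ k * (Real.log (m k) - Real.log (b k)))
    (hsum : ∑ k ∈ Finset.range L, τ k < 1) :
    ∃ Win : ℕ → Finset ι, (Win 0).Nonempty ∧ ∀ k < L, ∀ s ∈ Win k, ∀ B : Finset (β k),
      (B.card : ℝ) ≤ b k → ∃ s' ∈ Win (k + 1), Agree V (P k) s s' ∧ y k s' ∉ B := by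
  classical
  have hc : (0 : ℝ) < Fintype.card ι := by exact_mod_cast Fintype.card_pos
  have main : ∀ d k, k + d = L → ∃ Win : ℕ → Finset ι,
      (1 - ∑ i ∈ Finset.Ico k L, τ i) * Fintype.card ι ≤ ((Win k).card : ℝ) ∧
      ∀ j, k ≤ j → j < L → ∀ s ∈ Win j, ∀ B : Finset (β j),
      (B.card : ℝ) ≤ b j → ∃ s' ∈ Win (j + 1), Agree V (P j) s s' ∧ y j s' ∉ B := by
    intro d
    induction d with
    | zero =>
      intro k hk
      refine ⟨fun _ => Finset.univ, ?_, ?_⟩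
      · have : k = L := by omega
        subst this
        simp
      · intro j h1 h2
        omega
    | succ d ih =>
      intro k hk
      obtain ⟨Win, h1, h2⟩ := ih (k + 1) (by omega)
      have hkL : k < L := by omega
      set G : Finset ι := Finset.univ.filter (fun s => ∀ B : Finset (β k), (B.card : ℝ) ≤ b k →
        ∃ s' ∈ Win (k + 1), Agree V (P k) s s' ∧ y k s' ∉ B) with hG
      set W := Win (k + 1) \ G with hW
      have hWB : ∀ s, (((W.filter (fun s' => Agree V (P k) s s')).image (y k)).card : ℝ) ≤ b k := by
        intro s
        rcases (W.filter (fun s' => Agree V (P k) s s')).eq_empty_or_nonempty with he | ⟨s', hs'⟩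
        · rw [he]; simpa using (hb k).le
        · obtain ⟨hs1, hs2⟩ := Finset.mem_filter.1 hs'
          have hs3 : s' ∉ G := (Finset.mem_sdiff.1 hs1).2
          rw [hG, Finset.mem_filter] at hs3
          push Not at hs3
          obtain ⟨B, hB1, hB2⟩ := hs3 (Finset.mem_univ _)
          refine le_trans ?_ hB1
          have : (W.filter (fun s' => Agree V (P k) s s')).image (y k) ⊆ B := by
            intro v hv
            obtain ⟨s'', h3, rfl⟩ := Finset.mem_image.1 hv
            obtain ⟨h4, h5⟩ := Finset.mem_filter.1 h3
            exact hB2 s'' (Finset.mem_sdiff.1 h4).1 (hs2.symm.trans h5)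
          exact_mod_cast Finset.card_le_card this
      have key := ent_cond_le V (P k) (F k) (y k) (hy k) W (b k) (m k) (hb k) (hm k)
        (by intro s; convert hWB s) (by
          intro s
          have := hM k hkL (Finset.univ.filter (fun s' => Agree V (P k) s s'))
          convert this)
      have h3 := hτ k hkL
      have h4 := hbm k hkL
      have h5 : (W.card / Fintype.card ι : ℝ) * (Real.log (m k) - Real.log (b k)) ≤
          τ k * (Real.log (m k) - Real.log (b k)) := by linarith
      have h6 : (W.card / Fintype.card ι : ℝ) ≤ τ k :=
        le_of_mul_le_mul_right h5 (by linarith)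
      rw [div_le_iff₀ hc] at h6
      have h7 : ((Win (k + 1)).card : ℝ) ≤ W.card + G.card := by
        have : (Win (k + 1)).card ≤ W.card + G.card := by
          have a1 := Finset.card_le_card (s := Win (k + 1)) (t := W ∪ G) (by
            intro x hx
            by_cases hxG : x ∈ G
            · exact Finset.mem_union_right _ hxG
            · exact Finset.mem_union_left _ (Finset.mem_sdiff.2 ⟨hx, hxG⟩))
          exact a1.trans (Finset.card_union_le _ _)
        exact_mod_cast this
      refine ⟨Function.update Win k G, ?_, ?_⟩
      · rw [Function.update_self]
        have e : ∑ i ∈ Finset.Ico k L, τ i = τ k + ∑ i ∈ Finset.Ico (k + 1) L, τ i :=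
          Finset.sum_eq_sum_Ico_succ_bot hkL τ
        rw [e]
        linarith
      · intro j hj1 hj2 s hs B hB
        rcases Nat.eq_or_lt_of_le hj1 with rfl | hlt
        · rw [Function.update_self] at hs
          rw [Function.update_of_ne (by omega)]
          exact (Finset.mem_filter.1 hs).2 B hB
        · rw [Function.update_of_ne (by omega)] at hs
          rw [Function.update_of_ne (by omega)]
          exact h2 j hlt hj2 s hs B hB
  obtain ⟨Win, h1, h2⟩ := main L 0 (by omega)
  refine ⟨Win, ?_, fun k hk => h2 k (Nat.zero_le _) hk⟩
  rw [← Finset.card_pos]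
  rw [← Finset.range_eq_Ico] at h1
  have : (0 : ℝ) < ((Win 0).card : ℝ) := lt_of_lt_of_le (by
    apply mul_pos _ hc
    linarith) h1
  exact_mod_cast this

lemma seq_choice {ι A N : Type*} [Fintype A] [DecidableEq N] (y : ι → N) (G : A → ι → Prop)
    (ball : N → Finset N) (hsym : ∀ f g, f ∈ ball g → g ∈ ball f) (b c : ℝ)
    (hG : ∀ a, ∀ B : Finset N, (B.card : ℝ) ≤ b → ∃ s, G a s ∧ y s ∉ B)
    (hball : ∀ g, ((ball g).card : ℝ) ≤ c) (hc : 0 ≤ c) (hcb : c * Fintype.card A ≤ b) :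
    ∃ σ : A → ι, (∀ a, G a (σ a)) ∧ ∀ a a', a ≠ a' → y (σ a) ∉ ball (y (σ a')) := by
  classical
  have main : ∀ S : Finset A, ∃ σ : A → ι, (∀ a ∈ S, G a (σ a)) ∧
      ∀ a ∈ S, ∀ a' ∈ S, a ≠ a' → y (σ a) ∉ ball (y (σ a')) := by
    intro S
    induction S using Finset.induction_on with
    | empty =>
      have : ∀ a, ∃ s, G a s := fun a => by
        obtain ⟨s, hs, _⟩ := hG a ∅ (by
          simp only [Finset.card_empty, Nat.cast_zero]
          exact le_trans (by positivity) hcb)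
        exact ⟨s, hs⟩
      choose σ hσ using this
      exact ⟨σ, by simp, by simp⟩
    | insert a S ha ih =>
      obtain ⟨σ, h1, h2⟩ := ih
      obtain ⟨s, hs1, hs2⟩ := hG a (S.biUnion fun a' => ball (y (σ a'))) (by
        have e1 : (((S.biUnion fun a' => ball (y (σ a'))).card : ℕ) : ℝ) ≤
            ∑ a' ∈ S, ((ball (y (σ a'))).card : ℝ) := by
          exact_mod_cast Finset.card_biUnion_le
        refine e1.trans ((Finset.sum_le_sum fun a' _ => hball _).trans ?_)
        rw [Finset.sum_const, nsmul_eq_mul, mul_comm]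
        refine le_trans ?_ hcb
        gcongr
        exact Finset.card_le_univ S)
      have hne : ∀ a' ∈ S, a' ≠ a := fun a' h e => ha (e ▸ h)
      have hnb : ∀ a' ∈ S, y s ∉ ball (y (σ a')) := by
        intro a' ha' hb
        exact hs2 (Finset.mem_biUnion.2 ⟨a', ha', hb⟩)
      refine ⟨Function.update σ a s, ?_, ?_⟩
      · intro a' ha'
        rcases Finset.mem_insert.1 ha' with rfl | h
        · rwa [Function.update_self]
        · rw [Function.update_of_ne (hne a' h)]; exact h1 a' h
      · intro a1 ha1 a2 ha2 h12
        rcases Finset.mem_insert.1 ha1 with rfl | g1 <;> rcases Finset.mem_insert.1 ha2 with rfl | g2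
        · exact absurd rfl h12
        · rw [Function.update_self, Function.update_of_ne (hne a2 g2)]
          exact hnb a2 g2
        · rw [Function.update_self, Function.update_of_ne (hne a1 g1)]
          exact fun h => hnb a1 g1 (hsym _ _ h)
        · rw [Function.update_of_ne (hne a1 g1), Function.update_of_ne (hne a2 g2)]
          exact h2 a1 g1 a2 g2 h12
  obtain ⟨σ, h1, h2⟩ := main Finset.univ
  exact ⟨σ, fun a => h1 a (Finset.mem_univ _),
    fun a a' h => h2 a (Finset.mem_univ _) a' (Finset.mem_univ _) h⟩

lemma exists_tree {ι J : Type*} [DecidableEq J] (V : J → ι → ℕ)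
    (L K : ℕ) (P F : ℕ → Finset J) (ℓ : ℕ → ℕ) (y : ∀ k, ι → (Fin (ℓ k) → Fin (K + 1)))
    (hP : ∀ k, P (k + 1) = P k ∪ F k)
    (hy : ∀ k s s', Agree V (F k) s s' → y k s' = y k s)
    (b c : ℕ → ℝ) (δ : ℝ) (hc : ∀ k, 0 ≤ c k)
    (hball : ∀ k < L, ∀ g : Fin (ℓ k) → Fin (K + 1),
      ((Finset.univ.filter (fun f : Fin (ℓ k) → Fin (K + 1) =>
        ((Finset.univ.filter (fun i => f i ≠ g i)).card : ℝ) ≤ δ * ℓ k)).card : ℝ) ≤ c k)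
    (hcb : ∀ k < L, c k * 2 ^ (k + 1) ≤ b k)
    (Win : ℕ → Finset ι) (hW0 : (Win 0).Nonempty)
    (hW : ∀ k < L, ∀ s ∈ Win k, ∀ B : Finset (Fin (ℓ k) → Fin (K + 1)),
      (B.card : ℝ) ≤ b k → ∃ s' ∈ Win (k + 1), Agree V (P k) s s' ∧ y k s' ∉ B) :
    ∃ σ : (ℕ → Bool) → ι, (∀ w w', Agree V (P 0) (σ w) (σ w')) ∧
      ∀ k < L, ∀ w w', (∃ i ≤ k, w i ≠ w' i) →
        δ * ℓ k < ((Finset.univ.filter (fun i => y k (σ w) i ≠ y k (σ w') i)).card : ℝ) := by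
  classical
  have hPmono : ∀ j d, P j ⊆ P (j + d) := by
    intro j d
    induction d with
    | zero => exact Finset.Subset.refl _
    | succ d ih =>
      rw [← add_assoc, hP]
      exact ih.trans Finset.subset_union_left
  have hFP : ∀ j k, j < k → F j ⊆ P k := by
    intro j k hjk
    obtain ⟨d, rfl⟩ := Nat.exists_eq_add_of_lt hjk
    have := hPmono (j + 1) d
    rw [hP] at this
    rw [show j + d + 1 = j + 1 + d by omega]
    exact Finset.subset_union_right.trans (this)
  have main : ∀ k, k ≤ L → ∃ σ : (Fin k → Bool) → ι, (∀ w, σ w ∈ Win k) ∧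
      (∀ w w', Agree V (P 0) (σ w) (σ w')) ∧
      ∀ j < k, ∀ w w', (∃ i : Fin k, (i : ℕ) ≤ j ∧ w i ≠ w' i) →
        δ * ℓ j < ((Finset.univ.filter (fun i => y j (σ w) i ≠ y j (σ w') i)).card : ℝ) := by
    intro k
    induction k with
    | zero =>
      intro _
      obtain ⟨s, hs⟩ := hW0
      exact ⟨fun _ => s, fun _ => hs, fun _ _ => Agree.refl _ _ _, by intro j hj; omega⟩
    | succ k ih =>
      intro hk
      obtain ⟨σ, h1, h2, h3⟩ := ih (by omega)
      have hkL : k < L := by omega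
      obtain ⟨σ', g1, g2⟩ := seq_choice (A := Fin (k + 1) → Bool) (y k)
        (fun w s => s ∈ Win (k + 1) ∧ Agree V (P k) (σ (fun i => w i.castSucc)) s)
        (fun g => Finset.univ.filter (fun f : Fin (ℓ k) → Fin (K + 1) =>
          ((Finset.univ.filter (fun i => f i ≠ g i)).card : ℝ) ≤ δ * ℓ k))
        (by
          intro f g hfg
          simp only [Finset.mem_filter, Finset.mem_univ, true_and] at hfg ⊢
          simpa only [ne_comm] using hfg)
        (b k) (c k) (by
          intro w B hB
          obtain ⟨s', e1, e2, e3⟩ := hW k hkL _ (h1 (fun i => w i.castSucc)) B hB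
          exact ⟨s', ⟨e1, e2⟩, e3⟩)
        (hball k hkL) (hc k) (by
          have := hcb k hkL
          simpa using this)
      have hP0k : P 0 ⊆ P k := by simpa using hPmono 0 k
      refine ⟨σ', fun w => (g1 w).1, ?_, ?_⟩
      · intro w w'
        exact ((g1 w).2.mono hP0k).symm.trans ((h2 _ _).trans ((g1 w').2.mono hP0k))
      · intro j hj w w' hww
        obtain ⟨i, hij, hi⟩ := hww
        rcases Nat.lt_succ_iff_lt_or_eq.1 hj with hjk | rfl
        · have r1 : y j (σ' w) = y j (σ (fun i => w i.castSucc)) :=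
            hy j _ _ ((g1 w).2.mono (hFP j k hjk))
          have r2 : y j (σ' w') = y j (σ (fun i => w' i.castSucc)) :=
            hy j _ _ ((g1 w').2.mono (hFP j k hjk))
          rw [r1, r2]
          refine h3 j hjk _ _ ⟨⟨i, by omega⟩, hij, ?_⟩
          exact hi
        · have hne : w ≠ w' := fun e => hi (by rw [e])
          have := g2 w w' hne
          simp only [Finset.mem_filter, Finset.mem_univ, true_and, not_le] at this
          exact this
  obtain ⟨σ, h1, h2, h3⟩ := main L le_rfl
  refine ⟨fun w => σ (fun i => w i), fun w w' => h2 _ _, ?_⟩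
  rintro k hk w w' ⟨i, hik, hi⟩
  exact h3 k hk _ _ ⟨⟨i, by omega⟩, hik, hi⟩

end DC2

namespace DC2

/-! ### Finite-level families of orbits -/

variable {X : Type*} [MetricSpace X]

lemma ent_const {ι J : Type*} [Fintype ι] [Nonempty ι] (V : J → ι → ℕ) (F : Finset J)
    (h : ∀ s s', Agree V F s s') : ent V F = 0 := by
  classical
  have : ∀ s, fib V F s = Fintype.card ι := by
    intro s
    unfold fib
    simp [h]
  unfold ent
  simp [this]

lemma pick (e : ℕ → Finset (ℕ × ℕ) → ℝ) (H : Finset (ℕ × ℕ) → ℝ)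
    (hH : ∀ F, Tendsto (fun N => avg e N F) (hyperfilter ℕ) (nhds (H F)))
    (L : ℕ) (A B : ℕ → Finset (ℕ × ℕ)) (c D : ℕ → ℝ)
    (hlt : ∑ k ∈ Finset.range L, (c k - (H (A k) - H (B k))) / D k < 1) :
    ∃ N a, ∑ k ∈ Finset.range L,
      (c k - (e N (sh a (A k)) - e N (sh a (B k)))) / D k < 1 := by
  have t1 : Tendsto (fun N => ∑ k ∈ Finset.range L, (c k - (avg e N (A k) - avg e N (B k))) / D k)
      (hyperfilter ℕ) (nhds (∑ k ∈ Finset.range L, (c k - (H (A k) - H (B k))) / D k)) := by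
    apply tendsto_finsetSum
    intro k _
    exact (tendsto_const_nhds.sub ((hH _).sub (hH _))).div_const _
  have t2 := t1.eventually (gt_mem_nhds hlt)
  have t3 : ∀ᶠ N : ℕ in (hyperfilter ℕ : Filter ℕ), 0 < N :=
    Nat.hyperfilter_le_atTop (eventually_gt_atTop 0)
  obtain ⟨N, h1, h2⟩ := (t2.and t3).exists
  have hN : (0 : ℝ) < N := by exact_mod_cast h2
  refine ⟨N, ?_⟩
  by_contra hcon
  push Not at hcon
  have h3 : (N : ℝ) ≤ ∑ a ∈ Finset.range N, ∑ k ∈ Finset.range L,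
      (c k - (e N (sh a (A k)) - e N (sh a (B k)))) / D k := by
    calc (N : ℝ) = ∑ a ∈ Finset.range N, (1 : ℝ) := by simp
      _ ≤ _ := Finset.sum_le_sum fun a _ => hcon a
  rw [Finset.sum_comm] at h3
  have h4 : ∑ k ∈ Finset.range L, ∑ a ∈ Finset.range N,
      (c k - (e N (sh a (A k)) - e N (sh a (B k)))) / D k =
      N * ∑ k ∈ Finset.range L, (c k - (avg e N (A k) - avg e N (B k))) / D k := by
    rw [Finset.mul_sum]
    apply Finset.sum_congr rfl
    intro k _
    rw [← Finset.sum_div, Finset.sum_sub_distrib, Finset.sum_sub_distrib]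
    unfold avg
    simp only [Finset.sum_const, Finset.card_range, nsmul_eq_mul]
    field_simp
  rw [h4] at h3
  nlinarith

lemma exists_code [CompactSpace X] [Nonempty X] (k : ℕ) : ∃ (A : ℕ) (f : X → ℕ),
    (∀ x, f x < A) ∧ ∀ x y, f x = f y → dist x y ≤ 1 / ((k : ℝ) + 1) := by
  have hk : (0 : ℝ) < 1 / ((k : ℝ) + 1) := by positivity
  obtain ⟨K, pc, hpc⟩ := exists_cover (X := X) (1 / ((k : ℝ) + 1) / 2) (by positivity)
  choose c hc using hpc
  refine ⟨K + 1, fun x => c x, fun x => (c x).2, ?_⟩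
  intro x y hxy
  have e : c x = c y := Fin.ext hxy
  have h1 := hc x
  have h2 := hc y
  rw [e] at h1
  have := dist_triangle_right x y (pc (c y))
  linarith

lemma exists_orbits [CompactSpace X] [Nonempty X] (T : X → X)
    (hent : 0 < Dynamics.coverEntropy T (Set.univ : Set X)) :
    ∃ (t δ : ℝ) (n : ℕ → ℕ), 0 < t ∧ 0 < δ ∧ (∀ j, 0 < n j) ∧ (∀ j, 2 * mm n j ≤ n (j + 1)) ∧
      ∀ L, ∃ x : (ℕ → Bool) → X,
        (∀ k < L, ∀ w w', ∀ i ∈ Finset.Ico (n k) (mm n k),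
          dist (T^[i] (x w)) (T^[i] (x w')) ≤ 1 / ((k : ℝ) + 1)) ∧
        (∀ k < L, ∀ w w', (∃ i ≤ k, w i ≠ w' i) →
          δ * ((n (k + 1) - mm n k : ℕ) : ℝ) ≤ (((Finset.Ico (mm n k) (n (k + 1))).filter
            (fun i => t ≤ dist (T^[i] (x w)) (T^[i] (x w')))).card : ℝ)) := by
  classical
  obtain ⟨t, K, h, ht, hh, hlow, hup⟩ := exists_growth T hent
  obtain ⟨δ, hδ, hham⟩ := hamming (Fin (K + 1)) (h / 8) (by positivity)
  have hcfg := fun N => Nmax_spec T t K N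
  choose p Y0 hrob0 hinj0 using hcfg
  let Y : ∀ N : ℕ, ℕ → Fin (Nmax T t K N) → Fin (K + 1) := fun N i s =>
    if i < N then Y0 N i s else 0
  have hrob : ∀ N i s s', Y N i s ≠ Y N i s' → t ≤ dist (T^[i] (p N s)) (T^[i] (p N s')) := by
    intro N i s s' hne
    by_cases hi : i < N
    · simp only [Y, if_pos hi] at hne
      exact hrob0 N i s s' hne
    · simp only [Y, if_neg hi] at hne
      exact absurd rfl hne
  choose A0 f hf hfd using fun k => exists_code (X := X) k
  let V : ∀ N : ℕ, ℕ × ℕ → Fin (Nmax T t K N) → ℕ := fun N q s =>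
    if q.1 = 0 then (Y N q.2 s : ℕ) else f q.1 (T^[q.2] (p N s))
  let A : ℕ → ℕ := fun k => if k = 0 then K + 1 else A0 k
  have hVA : ∀ N q s, V N q s < A q.1 := by
    intro N q s
    simp only [V, A]
    split_ifs
    · exact (Y N q.2 s).2
    · exact hf _ _
  have hne : ∀ N, Nonempty (Fin (Nmax T t K N)) := fun N => ⟨⟨0, Nmax_pos T t K N⟩⟩
  obtain ⟨H, hH, hY, hlim⟩ := exists_limit (fun N F => ent (V N) F)
    (fun N => ent_empty _) (fun N F G hFG => ent_mono _ hFG)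
    (fun N A B C hA hB => ent_submod _ A B C hA hB)
    (fun k => Real.log 2 + Real.log (A k)) (fun N F => ent_le_sum (V N) A (hVA N) F) h (by
      intro N n
      have e1 : ent (V N) (Blk 1 N (N + n)) = 0 := by
        apply ent_const
        intro s s' q hq
        rw [mem_Blk] at hq
        have q0 : q.1 = 0 := by omega
        have q1 : ¬ q.2 < N := by omega
        simp only [V, if_pos q0, Y, if_neg q1]
      have e2 : ent (V N) (Blk 1 0 (N + n)) = Real.log (Nmax T t K N) := by
        rw [ent_of_inj]
        · simp
        · intro s s' hs
          apply hinj0 N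
          intro i hi
          have := hs (0, i) (by rw [mem_Blk]; simp; omega)
          simp only [V, Y, if_pos hi, if_true] at this
          exact (Fin.ext this).symm
      rw [e1, e2, sub_zero, Real.le_log_iff_exp_le (by exact_mod_cast Nmax_pos T t K N)]
      exact hlow N)
  set θ : ℝ := h / 100 with hθ
  have hθ0 : 0 < θ := by positivity
  let η : ℕ → ℝ := fun k => θ * (1 / 2) ^ k
  have hη : ∀ k, 0 < η k := fun k => by simp only [η]; positivity
  obtain ⟨n, hn0, hmn, hEx, hgap⟩ := exists_scales hH h hY θ hθ0 (by linarith)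
    (fun j b n => 2 * ((j + 2) * b) ≤ n ∧ 0 < n - (j + 2) * b ∧
      Real.log 2 ≤ η j * ((n - (j + 2) * b : ℕ) : ℝ) ∧
      (Nmax T t K (n - (j + 2) * b) : ℝ) ≤
        Real.exp ((h + η j) * ((n - (j + 2) * b : ℕ) : ℝ)) ∧
      Real.exp (h / 8 * ((n - (j + 2) * b : ℕ) : ℝ)) * 2 ^ (j + 1) ≤
        Real.exp (h / 4 * ((n - (j + 2) * b : ℕ) : ℝ)))
    (by
      intro j b
      have ts := tendsto_sub_atTop_nat ((j + 2) * b)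
      have c1 : ∀ᶠ l : ℕ in atTop, Real.log 2 ≤ η j * (l : ℝ) :=
        (tendsto_natCast_atTop_atTop.const_mul_atTop (hη j)).eventually_ge_atTop _
      have c2 := hup (η j) (hη j)
      have c3 : ∀ᶠ l : ℕ in atTop, (2 : ℝ) ^ (j + 1) ≤ Real.exp (h / 8 * l) :=
        (Real.tendsto_exp_atTop.comp (tendsto_natCast_atTop_atTop.const_mul_atTop
          (show 0 < h / 8 by positivity))).eventually_ge_atTop _
      filter_upwards [eventually_ge_atTop (2 * ((j + 2) * b)), ts.eventually c1,
        ts.eventually c2, ts.eventually c3, ts.eventually (eventually_gt_atTop 0)]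
        with n h1 h2 h3 h4 h5
      refine ⟨h1, h5, h2, h3, ?_⟩
      calc _ ≤ Real.exp (h / 8 * ((n - (j + 2) * b : ℕ) : ℝ)) *
            Real.exp (h / 8 * ((n - (j + 2) * b : ℕ) : ℝ)) := by gcongr
        _ = _ := by rw [← Real.exp_add]; ring_nf)
  let ℓ : ℕ → ℕ := fun k => n (k + 1) - mm n k
  have hℓ : ∀ k, 0 < ℓ k := fun k => (hEx k).2.1
  have hℓr : ∀ k, (0 : ℝ) < ℓ k := fun k => by exact_mod_cast hℓ k
  refine ⟨t, δ, n, ht, hδ, hn0, fun j => (hEx j).1, ?_⟩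
  intro L
  let m : ℕ → ℝ := fun k => Real.exp ((h + η k) * ℓ k)
  let b : ℕ → ℝ := fun k => Real.exp (h / 4 * ℓ k)
  let D : ℕ → ℝ := fun k => Real.log (m k) - Real.log (b k)
  have hD : ∀ k, 3 / 4 * h * ℓ k ≤ D k := by
    intro k
    simp only [D, m, b, Real.log_exp]
    have := mul_pos (hη k) (hℓr k)
    linarith
  have hD0 : ∀ k, 0 < D k := fun k => lt_of_lt_of_le (mul_pos (by positivity) (hℓr k)) (hD k)
  obtain ⟨N, a, hNa⟩ := pick (fun N F => ent (V N) F) H hlim L (fun k => Ps n L k ∪ Fs n k)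
    (fun k => Ps n L k) (fun k => Real.log 2 + Real.log (m k)) D (by
      have s1 : ∀ k ∈ Finset.range L, (Real.log 2 + Real.log (m k) -
          (H (Ps n L k ∪ Fs n k) - H (Ps n L k))) / D k ≤ 1 / 10 * (1 / 2) ^ k := by
        intro k hk
        have g1 := hgap L k (Finset.mem_range.1 hk)
        have g2 : Real.log 2 ≤ η k * (ℓ k : ℝ) := (hEx k).2.2.1
        have g3 : (h - 3 * η k) * (ℓ k : ℝ) ≤ H (Ps n L k ∪ Fs n k) - H (Ps n L k) := g1
        rw [div_le_iff₀ (hD0 k)]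
        have g4 : Real.log (m k) = (h + η k) * ℓ k := Real.log_exp _
        rw [g4]
        have g5 : 1 / 10 * (1 / 2 : ℝ) ^ k * (3 / 4 * h * ℓ k) ≤ 1 / 10 * (1 / 2) ^ k * D k := by
          have := hD k
          gcongr
        have g6 : 1 / 10 * (1 / 2 : ℝ) ^ k * (3 / 4 * h * ℓ k) = 15 / 2 * (η k * ℓ k) := by
          simp only [η, hθ]; ring
        have := mul_pos (hη k) (hℓr k)
        linarith
      refine lt_of_le_of_lt (Finset.sum_le_sum s1) ?_
      rw [← Finset.mul_sum]
      have s2 : ∑ k ∈ Finset.range L, (1 / 2 : ℝ) ^ k ≤ 2 := sum_geometric_two_le L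
      linarith)
  let P : ℕ → Finset (ℕ × ℕ) := fun k => sh a (Ps n L k)
  let F : ℕ → Finset (ℕ × ℕ) := fun k => sh a (Fs n k)
  let y : ∀ k, Fin (Nmax T t K N) → (Fin (ℓ k) → Fin (K + 1)) := fun k s i =>
    Y N (a + mm n k + i) s
  have hFmem : ∀ k q, q ∈ F k ↔ q.1 < 1 ∧ mm n k + a ≤ q.2 ∧ q.2 < n (k + 1) + a := by
    intro k q
    simp only [F, Fs, sh_Blk, mem_Blk]
  have hy1 : ∀ k s s', y k s' = y k s → Agree (V N) (F k) s s' := by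
    intro k s s' hyk q hq
    rw [hFmem] at hq
    have q0 : q.1 = 0 := by omega
    have := congrFun hyk ⟨q.2 - (a + mm n k), by simp only [ℓ]; omega⟩
    simp only [y] at this
    rw [show a + mm n k + (q.2 - (a + mm n k)) = q.2 by omega] at this
    simp only [V, if_pos q0, this]
  have hy2 : ∀ k s s', Agree (V N) (F k) s s' → y k s' = y k s := by
    intro k s s' hag
    funext i
    have hi : (i : ℕ) < n (k + 1) - mm n k := i.2
    have := hag (0, a + mm n k + i) ((hFmem _ _).2 (by simp only; omega))
    simp only [V, if_true] at this
    exact Fin.ext this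
  obtain ⟨Win, hW0, hW⟩ := exists_win (V N) L P F (fun k => Fin (ℓ k) → Fin (K + 1)) y hy1 b m
    (fun k => (Real.log 2 + Real.log (m k) - (ent (V N) (P k ∪ F k) - ent (V N) (P k))) / D k)
    (fun k => Real.exp_pos _) (fun k _ => by have := hD0 k; simp only [D] at this; linarith)
    (fun k => Real.exp_pos _) (by
      intro k _ S
      have w1 := window T t K (p N) (Y N) (hrob N) (a + mm n k) (ℓ k)
      have w2 : (S.image (y k)).card ≤ Nmax T t K (ℓ k) :=
        (Finset.card_le_card (Finset.image_subset_image (Finset.subset_univ S))).trans w1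
      have w3 : (Nmax T t K (ℓ k) : ℝ) ≤ m k := (hEx k).2.2.2.1
      have w4 : ((S.image (y k)).card : ℝ) ≤ m k := le_trans (by exact_mod_cast w2) w3
      convert w4) (by
      intro k _
      exact (div_mul_cancel₀ _ (hD0 k).ne').ge) (by
      simp only [sh_union] at hNa
      exact hNa)
  obtain ⟨σ, hσ1, hσ2⟩ := exists_tree (V N) L K P F ℓ y
    (fun k => by simp only [P, F, Ps_succ, sh_union]) hy2 b (fun k => Real.exp (h / 8 * ℓ k)) δ
    (fun k => (Real.exp_pos _).le) (fun k _ g => hham (ℓ k) g) (fun k _ => (hEx k).2.2.2.2)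
    Win hW0 hW
  refine ⟨fun w => T^[a] (p N (σ w)), ?_, ?_⟩
  · intro k hk w w' i hi
    have hi := Finset.mem_Ico.1 hi
    have hmem : (k + 1, i + a) ∈ P 0 := by
      simp only [P, sh, Finset.mem_image]
      refine ⟨(k + 1, i), ?_, rfl⟩
      unfold Ps
      apply Finset.mem_union_left
      refine Finset.mem_biUnion.2 ⟨k, Finset.mem_range.2 hk, ?_⟩
      simp only [Cl, Finset.mem_product, Finset.mem_singleton, Finset.mem_Ico, true_and]
      exact hi
    have e := hσ1 w w' _ hmem
    simp only [V, Nat.succ_ne_zero, if_false] at e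
    have := hfd (k + 1) _ _ e.symm
    rw [← Function.iterate_add_apply, ← Function.iterate_add_apply]
    refine this.trans ?_
    push_cast
    apply one_div_le_one_div_of_le <;> nlinarith [(Nat.cast_nonneg k : (0 : ℝ) ≤ k)]
  · intro k hk w w' hww
    refine (hσ2 k hk w w' hww).le.trans ?_
    have : (Finset.univ.filter (fun i => y k (σ w) i ≠ y k (σ w') i)).card ≤
        ((Finset.Ico (mm n k) (n (k + 1))).filter (fun i => t ≤ dist (T^[i] (T^[a] (p N (σ w))))
          (T^[i] (T^[a] (p N (σ w')))))).card := by
      apply Finset.card_le_card_of_injOn (fun i : Fin (ℓ k) => mm n k + (i : ℕ))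
      · intro i hi
        have hi1 := (Finset.mem_filter.1 hi).2
        have hi2 : (i : ℕ) < n (k + 1) - mm n k := i.2
        simp only [Finset.coe_filter, Set.mem_ofPred_eq, Finset.mem_Ico]
        refine ⟨by omega, ?_⟩
        rw [← Function.iterate_add_apply, ← Function.iterate_add_apply]
        have := hrob N _ _ _ hi1
        rwa [show a + mm n k + (i : ℕ) = mm n k + i + a by omega] at this
      · intro i _ j _ hij
        simp only at hij
        exact Fin.ext (by omega)
    exact_mod_cast this

end DC2

namespace DC2

/-! ### Passing to the limit -/

variable {X : Type*} [MetricSpace X]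

lemma exists_limit_orbits [CompactSpace X] [Nonempty X] (T : X → X) (hT : Continuous T)
    (hent : 0 < Dynamics.coverEntropy T (Set.univ : Set X)) :
    ∃ (t δ : ℝ) (n : ℕ → ℕ), 0 < t ∧ 0 < δ ∧ (∀ j, 0 < n j) ∧ (∀ j, 2 * mm n j ≤ n (j + 1)) ∧
      ∃ x : (ℕ → Bool) → X,
        (∀ k, ∀ w w', ∀ i ∈ Finset.Ico (n k) (mm n k),
          dist (T^[i] (x w)) (T^[i] (x w')) ≤ 1 / ((k : ℝ) + 1)) ∧
        (∀ k, ∀ w w', (∃ i ≤ k, w i ≠ w' i) →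
          δ * ((n (k + 1) - mm n k : ℕ) : ℝ) ≤ (((Finset.Ico (mm n k) (n (k + 1))).filter
            (fun i => t ≤ dist (T^[i] (x w)) (T^[i] (x w')))).card : ℝ)) := by
  obtain ⟨t, δ, n, ht, hδ, hn, hmn, hx⟩ := exists_orbits T hent
  choose x hx1 hx2 using hx
  have hz : ∀ w, ∃ z : X, Tendsto (fun L => x L w) (hyperfilter ℕ) (nhds z) := by
    intro w
    obtain ⟨y, _, hy⟩ := (isCompact_univ : IsCompact (Set.univ : Set X)).ultrafilter_le_nhds
      ((hyperfilter ℕ).map (fun L => x L w)) (by simp)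
    exact ⟨y, hy⟩
  choose z hz using hz
  have hd : ∀ i w w', Tendsto (fun L => dist (T^[i] (x L w)) (T^[i] (x L w'))) (hyperfilter ℕ)
      (nhds (dist (T^[i] (z w)) (T^[i] (z w')))) := by
    intro i w w'
    have hc := (hT.iterate i)
    exact ((hc.tendsto _).comp (hz w)).dist ((hc.tendsto _).comp (hz w'))
  have hev : ∀ k, ∀ᶠ L in (hyperfilter ℕ : Filter ℕ), k < L := fun k =>
    Nat.hyperfilter_le_atTop (eventually_gt_atTop k)
  refine ⟨t, δ, n, ht, hδ, hn, hmn, z, ?_, ?_⟩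
  · intro k w w' i hi
    refine le_of_tendsto (hd i w w') ?_
    filter_upwards [hev k] with L hL
    exact hx1 L k hL w w' i hi
  · intro k w w' hww
    have h1 : ∀ᶠ L in (hyperfilter ℕ : Filter ℕ), ∀ i ∈ Finset.Ico (mm n k) (n (k + 1)),
        t ≤ dist (T^[i] (x L w)) (T^[i] (x L w')) → t ≤ dist (T^[i] (z w)) (T^[i] (z w')) := by
      rw [Filter.eventually_all_finset]
      intro i _
      by_cases hi : t ≤ dist (T^[i] (z w)) (T^[i] (z w'))
      · exact Filter.Eventually.of_forall fun L _ => hi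
      · have := (hd i w w').eventually (gt_mem_nhds (not_le.1 hi))
        filter_upwards [this] with L hL hL'
        exact absurd hL' (not_le.2 hL)
    obtain ⟨L, hL1, hL2⟩ := (h1.and (hev k)).exists
    refine (hx2 L k hL2 w w' hww).trans ?_
    have : ((Finset.Ico (mm n k) (n (k + 1))).filter
            (fun i => t ≤ dist (T^[i] (x L w)) (T^[i] (x L w')))).card ≤
        ((Finset.Ico (mm n k) (n (k + 1))).filter
            (fun i => t ≤ dist (T^[i] (z w)) (T^[i] (z w')))).card := by
      apply Finset.card_le_card
      intro i hi
      obtain ⟨h3, h4⟩ := Finset.mem_filter.1 hi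
      exact Finset.mem_filter.2 ⟨h3, hL1 i h3 h4⟩
    exact_mod_cast this

lemma ctf_nonneg (T : X → X) (x y : X) (t : ℝ) (n : ℕ) : 0 ≤ closeTimesFraction T x y t n := by
  unfold closeTimesFraction
  positivity

lemma ctf_le_one (T : X → X) (x y : X) (t : ℝ) (n : ℕ) : closeTimesFraction T x y t n ≤ 1 := by
  unfold closeTimesFraction
  apply div_le_one_of_le₀ _ (Nat.cast_nonneg n)
  have := Finset.card_filter_le (Finset.range n) (fun i => dist (T^[i] x) (T^[i] y) < t)
  rw [Finset.card_range] at this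
  exact_mod_cast this

lemma isDC2Pair_of (T : X → X) (x y : X) (t δ : ℝ) (n : ℕ → ℕ) (ht : 0 < t) (hδ : 0 < δ)
    (hn : ∀ j, 0 < n j) (hmn : ∀ j, 2 * mm n j ≤ n (j + 1))
    (h1 : ∀ k, ∀ i ∈ Finset.Ico (n k) (mm n k), dist (T^[i] x) (T^[i] y) ≤ 1 / ((k : ℝ) + 1))
    (k0 : ℕ) (h2 : ∀ k, k0 ≤ k → δ * ((n (k + 1) - mm n k : ℕ) : ℝ) ≤
      (((Finset.Ico (mm n k) (n (k + 1))).filter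
        (fun i => t ≤ dist (T^[i] x) (T^[i] y))).card : ℝ)) : IsDC2Pair T x y := by
  have hmk : ∀ k, k ≤ mm n k := by
    intro k
    unfold mm
    nlinarith [hn k]
  refine ⟨?_, t, ht, ?_⟩
  · intro s hs
    have hbA : IsBoundedUnder (· ≤ ·) atTop (fun n : ℕ => closeTimesFraction T x y s n) :=
      isBoundedUnder_of ⟨1, fun n => ctf_le_one T x y s n⟩
    have hbB : IsBoundedUnder (· ≥ ·) atTop (fun n : ℕ => closeTimesFraction T x y s n) :=
      isBoundedUnder_of ⟨0, fun n => ctf_nonneg T x y s n⟩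
    apply le_antisymm
    · exact limsup_le_of_le hbB.isCoboundedUnder_le
        (Filter.Eventually.of_forall fun n => ctf_le_one T x y s n)
    · apply le_of_forall_lt
      intro c hc
      obtain ⟨c', hc1, hc2⟩ := exists_between hc
      refine lt_of_lt_of_le hc1 ?_
      refine le_limsup_of_frequently_le ?_ hbA
      rw [frequently_atTop]
      intro a
      have e1 : ∀ᶠ k : ℕ in atTop, 1 / ((k : ℝ) + 1) < s :=
        tendsto_one_div_add_atTop_nhds_zero_nat.eventually (gt_mem_nhds hs)
      have e2 : ∀ᶠ k : ℕ in atTop, 1 / ((k : ℝ) + 1) < 1 - c' :=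
        tendsto_one_div_add_atTop_nhds_zero_nat.eventually (gt_mem_nhds (by linarith))
      obtain ⟨k, hk1, hk2, hk3⟩ := (e1.and (e2.and (eventually_ge_atTop a))).exists
      refine ⟨mm n k, hk3.trans (hmk k), ?_⟩
      have hmpos : 0 < mm n k := by unfold mm; have := hn k; positivity
      have hmr : (0 : ℝ) < mm n k := by exact_mod_cast hmpos
      unfold closeTimesFraction
      rw [le_div_iff₀ hmr]
      have hcard : mm n k - n k ≤ ((Finset.range (mm n k)).filter
          (fun i => dist (T^[i] x) (T^[i] y) < s)).card := by
        rw [← Nat.card_Ico]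
        apply Finset.card_le_card
        intro i hi
        have hi' := Finset.mem_Ico.1 hi
        exact Finset.mem_filter.2 ⟨Finset.mem_range.2 hi'.2, lt_of_le_of_lt (h1 k i hi) hk1⟩
      have hcard' : (mm n k : ℝ) - n k ≤ (((Finset.range (mm n k)).filter
          (fun i => dist (T^[i] x) (T^[i] y) < s)).card : ℝ) := by
        have : mm n k ≤ ((Finset.range (mm n k)).filter
          (fun i => dist (T^[i] x) (T^[i] y) < s)).card + n k := by omega
        have : (mm n k : ℝ) ≤ (((Finset.range (mm n k)).filter
          (fun i => dist (T^[i] x) (T^[i] y) < s)).card : ℝ) + n k := by exact_mod_cast this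
        linarith
      refine le_trans ?_ hcard'
      have hmm : (mm n k : ℝ) = (k + 2) * n k := by unfold mm; push_cast; ring
      have hnk : (0 : ℝ) < n k := by exact_mod_cast hn k
      rw [div_lt_iff₀ (by positivity)] at hk2
      rw [hmm]
      have hk0 : (0 : ℝ) ≤ k := Nat.cast_nonneg k
      nlinarith
  · have hbB : IsBoundedUnder (· ≥ ·) atTop (fun n : ℕ => closeTimesFraction T x y t n) :=
      isBoundedUnder_of ⟨0, fun n => ctf_nonneg T x y t n⟩
    refine lt_of_le_of_lt (b := 1 - δ / 2) ?_ (by linarith)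
    refine liminf_le_of_frequently_le ?_ hbB
    rw [frequently_atTop]
    intro a
    set k := max a k0 with hk
    have hka : a ≤ k := le_max_left _ _
    have hkk : k0 ≤ k := le_max_right _ _
    have hm1 := hmn k
    have hm2 := hmk k
    refine ⟨n (k + 1), by omega, ?_⟩
    have hnr : (0 : ℝ) < n (k + 1) := by exact_mod_cast hn (k + 1)
    unfold closeTimesFraction
    rw [div_le_iff₀ hnr]
    have h3 := h2 k hkk
    have hc : ((Finset.range (n (k + 1))).filter (fun i => dist (T^[i] x) (T^[i] y) < t)).card +
        ((Finset.Ico (mm n k) (n (k + 1))).filter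
        (fun i => t ≤ dist (T^[i] x) (T^[i] y))).card ≤ n (k + 1) := by
      rw [← Finset.card_union_of_disjoint]
      · conv_rhs => rw [← Finset.card_range (n (k + 1))]
        apply Finset.card_le_card
        intro i hi
        rcases Finset.mem_union.1 hi with h | h
        · exact (Finset.mem_filter.1 h).1
        · exact Finset.mem_range.2 (Finset.mem_Ico.1 (Finset.mem_filter.1 h).1).2
      · refine Finset.disjoint_left.2 ?_
        intro i h4 h5
        have a1 := (Finset.mem_filter.1 h4).2
        have a2 := (Finset.mem_filter.1 h5).2
        linarith
    have hc' : (((Finset.range (n (k + 1))).filter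
          (fun i => dist (T^[i] x) (T^[i] y) < t)).card : ℝ) +
        (((Finset.Ico (mm n k) (n (k + 1))).filter
        (fun i => t ≤ dist (T^[i] x) (T^[i] y))).card : ℝ) ≤ n (k + 1) := by exact_mod_cast hc
    have hl : (n (k + 1) : ℝ) ≤ 2 * ((n (k + 1) - mm n k : ℕ) : ℝ) := by
      have : n (k + 1) ≤ 2 * (n (k + 1) - mm n k) := by omega
      exact_mod_cast this
    nlinarith

lemma main_theorem [CompactSpace X] (T : X → X) (hT : Continuous T)
    (hent : 0 < Dynamics.coverEntropy T (Set.univ : Set X)) :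
    ∃ E : Set X, ¬ E.Countable ∧ ∀ x ∈ E, ∀ y ∈ E, x ≠ y → IsDC2Pair T x y := by
  rcases isEmpty_or_nonempty X with hX | hX
  · rw [Set.univ_eq_empty_iff.2 hX, Dynamics.coverEntropy_empty] at hent
    exact absurd hent (by simp)
  obtain ⟨t, δ, n, ht, hδ, hn, hmn, z, hz1, hz2⟩ := exists_limit_orbits T hT hent
  have hinj : Function.Injective z := by
    intro w w' hzw
    by_contra hne
    obtain ⟨i, hi⟩ := Function.ne_iff.1 hne
    have h := hz2 i w w' ⟨i, le_rfl, hi⟩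
    rw [hzw] at h
    simp only [dist_self, not_le.2 ht, Finset.filter_false, Finset.card_empty, Nat.cast_zero] at h
    have hmpos : 0 < mm n i := by unfold mm; have := hn i; positivity
    have h2 : 0 < n (i + 1) - mm n i := by have := hmn i; omega
    have h3 : (0 : ℝ) < ((n (i + 1) - mm n i : ℕ) : ℝ) := by exact_mod_cast h2
    have := mul_pos hδ h3
    linarith
  refine ⟨Set.range z, ?_, ?_⟩
  · intro hc
    have : Countable (ℕ → Bool) := by
      have := hc.to_subtype
      exact (Set.rangeFactorization_injective.2 hinj).countable
    obtain ⟨g, hg⟩ := exists_surjective_nat (ℕ → Bool)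
    obtain ⟨i, hi⟩ := hg (fun j => !(g j j))
    have := congrFun hi i
    simp at this
  · rintro _ ⟨w, rfl⟩ _ ⟨w', rfl⟩ hne
    have hww : w ≠ w' := fun e => hne (by rw [e])
    obtain ⟨i, hi⟩ := Function.ne_iff.1 hww
    exact isDC2Pair_of T (z w) (z w') t δ n ht hδ hn hmn (fun k => hz1 k w w') i
      (fun k hk => hz2 k w w' ⟨i, hk, hi⟩)

end DC2

/-- **Positive topological entropy implies DC2 chaos.** If `T` is a continuous self-map of a
compact metric space with positive topological entropy, then there is an uncountable set `E`
every pair of distinct points of which is DC2-scrambled. -/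
theorem positive_entropy_implies_DC2 {X : Type*} [MetricSpace X] [CompactSpace X]
    (T : X → X) (hT : Continuous T)
    (hent : 0 < Dynamics.coverEntropy T (Set.univ : Set X)) :
    ∃ E : Set X, ¬ E.Countable ∧
      ∀ x ∈ E, ∀ y ∈ E, x ≠ y → IsDC2Pair T x y := by
  exact DC2.main_theorem T hT hent
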